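/- E(ν) = 1 + o(1): for every δ > 0 there exists N_0 such that for all N ≥ N_0, |E(ν(n) | n ∈ Z_M) − 1| ≤ δ. -/

import Mathlib

open Finset Filter
open scoped Classical

noncomputable section

/-- `ε_k := 1/(2^k (k+4)!)`. -/
def epsk (k : ℕ) : ℝ := 1 / (2 ^ k * (Nat.factorial (k + 4)))

/-- `W(N) := ∏_{p ≤ w(N)} p`. -/
def Wprim (w : ℕ → ℕ) (N : ℕ) : ℕ := ∏ p ∈ (Finset.range (w N + 1)).filter Nat.Prime, p

/-- W-tricked von Mangoldt function. -/
def tildeLambda (W n : ℕ) : ℝ :=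
  if Nat.Prime (W * n + 1) then (Nat.totient W : ℝ) / W * Real.log (W * n + 1) else 0

/-- truncated divisor sum `Λ_R`. -/
def LambdaR (R : ℝ) (n : ℕ) : ℝ :=
  ∑ d ∈ n.divisors.filter (fun d : ℕ => (d : ℝ) ≤ R),
    ((ArithmeticFunction.moebius d : ℤ) : ℝ) * Real.log (R / (d : ℝ))

/-- the representative of `n : ZMod m` lying in `[N, N+m)`. -/
def reprN (N : ℕ) {m : ℕ} (n : ZMod m) : ℕ := N + (n - (N : ZMod m)).val

/-- the condition `ε_k M ≤ n - N ≤ 2 ε_k M` on the representative in `[N, N+m)`. -/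
def inWindow (k N : ℕ) {m : ℕ} (n : ZMod m) : Prop :=
  epsk k * m ≤ ((n - (N : ZMod m)).val : ℝ) ∧ ((n - (N : ZMod m)).val : ℝ) ≤ 2 * epsk k * m

/-- `R := M^(1/(k 2^(k+4)))`. -/
def Rpar (k m : ℕ) : ℝ := (m : ℝ) ^ ((1 : ℝ) / (k * 2 ^ (k + 4)))

/-- the Green–Tao majorant `ν`. -/
def nuGT (k N W : ℕ) {m : ℕ} (n : ZMod m) : ℝ :=
  if inWindow k N n then
    (Nat.totient W : ℝ) / W * (LambdaR (Rpar k m) (W * reprN N n + 1)) ^ 2 / Real.log (Rpar k m)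
  else 1

/-- the function `f`. -/
def fGT (k N W : ℕ) {m : ℕ} (n : ZMod m) : ℝ :=
  if inWindow k N n then tildeLambda W (reprN N n) / (k * 2 ^ (k + 5)) else 0

/-- the set of integers `n` with `ε_k M ≤ n - N ≤ 2 ε_k M`. -/
def windowSet (k N m : ℕ) : Finset ℕ :=
  (Finset.range (N + m + 1)).filter
    (fun n => epsk k * m ≤ (n : ℝ) - N ∧ (n : ℝ) - N ≤ 2 * epsk k * m)

/-- `E(Λ̃(n) | ε_k M ≤ n - N ≤ 2 ε_k M)`. -/
def avgWindow (k N m W : ℕ) : ℝ :=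
  (∑ n ∈ windowSet k N m, tildeLambda W n) / (windowSet k N m).card

/-- `E(g(x) | x ∈ Z_m)`. -/
def avgZ (m : ℕ) (g : ZMod m → ℝ) : ℝ := (∑ x ∈ Finset.range m, g (x : ZMod m)) / m

/-- `E(g(x) g(x+r) ⋯ g(x+(k-1)r) | x, r ∈ Z_m)`. -/
def apAvg (k m : ℕ) (g : ZMod m → ℝ) : ℝ :=
  (∑ x ∈ Finset.range m, ∑ r ∈ Finset.range m,
    ∏ i ∈ Finset.range k, g ((x : ZMod m) + (i : ZMod m) * (r : ZMod m))) / (m : ℝ) ^ 2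

/-- a rational number interpreted in `ZMod m`. -/
def ratZMod (q : ℚ) (m : ℕ) : ZMod m := (q.num : ZMod m) * (q.den : ZMod m)⁻¹

/-- the `(m₀,t₀,L₀)`-linear forms condition for a family `ν = ν_N : Z_{M(N)} → ℝ`. -/
def LinearFormsCondition (M : ℕ → ℕ) (ν : ∀ N : ℕ, ZMod (M N) → ℝ) (m₀ t₀ L₀ : ℕ) : Prop :=
  ∀ m t : ℕ, m ≤ m₀ → t ≤ t₀ →
    ∀ L : Fin m → Fin t → ℚ,
      (∀ i j, (L i j).num.natAbs ≤ L₀ ∧ (L i j).den ≤ L₀) →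
      (∀ i, L i ≠ 0) →
      (∀ i i', i ≠ i' → ∀ q : ℚ, L i ≠ q • L i') →
      ∀ δ : ℝ, 0 < δ → ∃ N₀ : ℕ, ∀ N ≥ N₀, L₀ < M N →
        ∀ b : Fin m → ZMod (M N),
          |(∑ x : Fin t → Fin (M N), ∏ i : Fin m,
              ν N (∑ j : Fin t, ratZMod (L i j) (M N) * ((x j : ℕ) : ZMod (M N)) + b i)) /
              (M N : ℝ) ^ t - 1| ≤ δ

/-- the `m₀`-correlation condition for a family `ν = ν_N : Z_{M(N)} → ℝ`. -/
def CorrelationCondition (M : ℕ → ℕ) (ν : ∀ N : ℕ, ZMod (M N) → ℝ) (m₀ : ℕ) : Prop :=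
  ∀ m : ℕ, 1 < m → m ≤ m₀ →
    ∃ τ : ∀ N : ℕ, ZMod (M N) → ℝ,
      (∀ N n, 0 ≤ τ N n) ∧
      (∀ q : ℝ, 1 ≤ q → ∃ C : ℝ, ∀ N, avgZ (M N) (fun n => τ N n ^ q) ≤ C) ∧
      (∀ N : ℕ, ∀ h : Fin m → ZMod (M N),
        avgZ (M N) (fun x => ∏ i, ν N (x + h i)) ≤
          ∑ i : Fin m, ∑ j : Fin m, if i < j then τ N (h i - h j) else 0)

/-- `k`-pseudorandom measure. -/
def Pseudorandom (k : ℕ) (M : ℕ → ℕ) (ν : ∀ N : ℕ, ZMod (M N) → ℝ) : Prop :=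
  (∀ δ : ℝ, 0 < δ → ∃ N₀, ∀ N ≥ N₀, |avgZ (M N) (ν N) - 1| ≤ δ) ∧
  LinearFormsCondition M ν (k * 2 ^ (k - 1)) (3 * k - 4) k ∧
  CorrelationCondition M ν (2 ^ (k - 1))

section Tauberian

open MeasureTheory FourierTransform Topology Complex

/-- A Schwartz function with compact support which takes the value `1` at the origin. -/
lemma exists_schwartzMap_compact_support_apply_zero :
    ∃ φ : SchwartzMap ℝ ℂ, HasCompactSupport φ ∧ φ 0 = 1 := by
  let b : ContDiffBump (0 : ℝ) := ⟨1, 2, one_pos, one_lt_two⟩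
  have hc : HasCompactSupport (fun x : ℝ => ((b x : ℝ) : ℂ)) :=
    b.hasCompactSupport.comp_left (g := fun x : ℝ => (x : ℂ)) (by simp)
  have hd : ContDiff ℝ (↑(⊤ : ℕ∞)) (fun x : ℝ => ((b x : ℝ) : ℂ)) :=
    Complex.ofRealCLM.contDiff.comp b.contDiff
  refine ⟨hc.toSchwartzMap hd, hc, ?_⟩
  have : b 0 = 1 := b.one_of_mem_closedBall (by simp [b])
  change ((b 0 : ℝ) : ℂ) = 1
  simp [this]

lemma integral_fourier_schwartzMap (φ : SchwartzMap ℝ ℂ) : ∫ v : ℝ, 𝓕 (φ : ℝ → ℂ) v = φ 0 := by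
  have h := congrFun (Continuous.fourierInv_fourier_eq φ.continuous φ.integrable
    (by rw [← SchwartzMap.fourier_coe]; exact SchwartzMap.integrable _)) 0
  rw [Real.fourierInv_eq] at h
  simpa using h

lemma norm_laplace_kernel {σ : ℝ} (u t : ℝ) :
    ‖cexp (-((σ : ℂ) + (t : ℂ) * I) * u)‖ = Real.exp (-σ * u) := by
  rw [Complex.norm_exp]; simp

variable {F : ℝ → ℂ} {G : ℂ → ℂ} {B C : ℝ}

lemma continuousOn_of_local_lipschitz
    (hL : ∀ u v, 0 ≤ u → u ≤ v → v ≤ u + 1 → ‖F v - F u‖ ≤ C * (v - u)) :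
    ContinuousOn F (Set.Ioi 0) := by
  have hC : 0 ≤ C := by simpa using (norm_nonneg _).trans (hL 0 1 le_rfl zero_le_one (by simp))
  intro x hx
  apply ContinuousAt.continuousWithinAt
  rw [Metric.continuousAt_iff]
  intro ε hε
  have hx' : (0 : ℝ) < x := hx
  refine ⟨min (min x 1) (ε / (C + 1)), by positivity, fun {y} hy => ?_⟩
  simp only [lt_min_iff, Real.dist_eq] at hy
  obtain ⟨⟨hy1, hy2⟩, hy3⟩ := hy
  rw [lt_div_iff₀ (by positivity)] at hy3
  have key : ‖F y - F x‖ ≤ C * |y - x| := by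
    rw [abs_lt] at hy1 hy2
    rcases le_total x y with h | h
    · rw [abs_of_nonneg (by linarith)]
      exact hL x y hx'.le h (by linarith)
    · rw [abs_of_nonpos (by linarith), norm_sub_rev, neg_sub]
      exact hL y x (by linarith) h (by linarith)
  rw [dist_eq_norm]
  nlinarith [abs_nonneg (y - x)]

lemma integrableOn_fourier_smoothing (φ : SchwartzMap ℝ ℂ) (hF : ContinuousOn F (Set.Ioi 0))
    (hB : ∀ u, 0 ≤ u → ‖F u‖ ≤ B) {l : ℝ} (hl : 0 < l) (y : ℝ) :
    IntegrableOn (fun u => F u * 𝓕 (φ : ℝ → ℂ) (l * (u - y))) (Set.Ioi 0) := by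
  have hΦ : Integrable (𝓕 (φ : ℝ → ℂ)) := by
    rw [← SchwartzMap.fourier_coe]; exact SchwartzMap.integrable _
  refine Integrable.bdd_mul (c := B)
    ((hΦ.comp_mul_left' hl.ne').comp_sub_right y).integrableOn
    (hF.aestronglyMeasurable measurableSet_Ioi) ?_
  exact (ae_restrict_mem measurableSet_Ioi).mono fun u hu => hB u (le_of_lt hu)

lemma laplace_smoothing_identity (φ : SchwartzMap ℝ ℂ) (hF : ContinuousOn F (Set.Ioi 0))
    (hB : ∀ u, 0 ≤ u → ‖F u‖ ≤ B)
    (hG : ∀ s : ℂ, 0 < s.re → ∫ u in Set.Ioi (0 : ℝ), F u * cexp (-s * u) = G s)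
    {l : ℝ} (y : ℝ) {σ : ℝ} (hσ : 0 < σ) :
    ∫ t : ℝ, φ t * G (σ + (2 * Real.pi * l * t : ℝ) * I) * cexp ((2 * Real.pi * l * t * y : ℝ) * I)
      = ∫ u in Set.Ioi (0 : ℝ), Real.exp (-σ * u) * (F u * 𝓕 (φ : ℝ → ℂ) (l * (u - y))) := by
  have h_int : Integrable (Function.uncurry fun (t u : ℝ) => φ t * (F u *
      cexp (-((σ : ℂ) + (2 * Real.pi * l * t : ℝ) * I) * u)) *
        cexp ((2 * Real.pi * l * t * y : ℝ) * I))
      ((volume : Measure ℝ).prod (volume.restrict (Set.Ioi (0 : ℝ)))) := by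
    have h1 : Integrable (fun u : ℝ => B * Real.exp (-σ * u)) (volume.restrict (Set.Ioi (0 : ℝ))) :=
      (integrableOn_exp_mul_Ioi (by linarith) 0).const_mul B
    have h2 := (φ.integrable (μ := volume)).norm.mul_prod h1
    refine h2.mono' ?_ ?_
    · have hFm := (hF.aestronglyMeasurable (μ := volume) measurableSet_Ioi).comp_snd
        (μ := (volume : Measure ℝ))
      refine AEStronglyMeasurable.mul (AEStronglyMeasurable.mul ?_ (hFm.mul ?_)) ?_
      · exact (φ.continuous.comp continuous_fst).aestronglyMeasurable
      · exact Continuous.aestronglyMeasurable (by fun_prop)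
      · exact Continuous.aestronglyMeasurable (by fun_prop)
    · have : ∀ᵐ z ∂((volume : Measure ℝ).prod (volume.restrict (Set.Ioi (0 : ℝ)))),
          z.2 ∈ Set.Ioi (0 : ℝ) :=
        Measure.quasiMeasurePreserving_snd.ae (ae_restrict_mem measurableSet_Ioi)
      filter_upwards [this] with z hz
      simp only [Function.uncurry, norm_mul, norm_laplace_kernel, Complex.norm_exp_ofReal_mul_I,
        mul_one]
      gcongr
      exact hB _ (le_of_lt hz)
  calc _ = ∫ t : ℝ, ∫ u in Set.Ioi (0 : ℝ), φ t * (F u *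
      cexp (-((σ : ℂ) + (2 * Real.pi * l * t : ℝ) * I) * u)) *
        cexp ((2 * Real.pi * l * t * y : ℝ) * I) := by
        refine integral_congr_ae (.of_forall fun t => ?_)
        simp only
        rw [integral_mul_const, integral_const_mul, hG _ (by simpa using hσ)]
    _ = ∫ u in Set.Ioi (0 : ℝ), ∫ t : ℝ, φ t * (F u *
      cexp (-((σ : ℂ) + (2 * Real.pi * l * t : ℝ) * I) * u)) *
        cexp ((2 * Real.pi * l * t * y : ℝ) * I) := integral_integral_swap h_int
    _ = _ := by
        refine integral_congr_ae (.of_forall fun u => ?_)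
        simp only
        rw [Real.fourier_real_eq_integral_exp_smul, ← mul_assoc, ← integral_const_mul]
        refine integral_congr_ae (.of_forall fun t => ?_)
        simp only [smul_eq_mul]
        have : cexp (-((σ : ℂ) + (2 * Real.pi * l * t : ℝ) * I) * u) *
            cexp ((2 * Real.pi * l * t * y : ℝ) * I) = cexp (-σ * u : ℝ) *
            cexp ((-2 * Real.pi * t * (l * (u - y)) : ℝ) * I) := by
          rw [← Complex.exp_add, ← Complex.exp_add]
          congr 1; push_cast; ring
        rw [Complex.ofReal_exp]
        linear_combination φ t * F u * this

lemma laplace_smoothing_boundary_identity (φ : SchwartzMap ℝ ℂ) (hφ : HasCompactSupport φ)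
    (hF : ContinuousOn F (Set.Ioi 0)) (hB : ∀ u, 0 ≤ u → ‖F u‖ ≤ B)
    (hGc : ContinuousOn G {s | 0 ≤ s.re})
    (hG : ∀ s : ℂ, 0 < s.re → ∫ u in Set.Ioi (0 : ℝ), F u * cexp (-s * u) = G s)
    {l : ℝ} (hl : 0 < l) (y : ℝ) :
    ∫ t : ℝ, φ t * G ((2 * Real.pi * l * t : ℝ) * I) * cexp ((2 * Real.pi * l * t * y : ℝ) * I)
      = ∫ u in Set.Ioi (0 : ℝ), F u * 𝓕 (φ : ℝ → ℂ) (l * (u - y)) := by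
  have hIoc : ∀ᶠ σ : ℝ in 𝓝[>] 0, σ ∈ Set.Ioc (0 : ℝ) 1 := Ioc_mem_nhdsGT one_pos
  have hL : Tendsto (fun σ : ℝ => ∫ t : ℝ, φ t * G (σ + (2 * Real.pi * l * t : ℝ) * I) *
      cexp ((2 * Real.pi * l * t * y : ℝ) * I)) (𝓝[>] 0)
      (𝓝 (∫ t : ℝ, φ t * G ((2 * Real.pi * l * t : ℝ) * I) *
        cexp ((2 * Real.pi * l * t * y : ℝ) * I))) := by
    have hK : IsCompact (Set.Icc (0 : ℝ) 1 ×ˢ tsupport φ) := isCompact_Icc.prod hφ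
    have hGK : ContinuousOn (fun p : ℝ × ℝ => G (p.1 + (2 * Real.pi * l * p.2 : ℝ) * I))
        (Set.Icc (0 : ℝ) 1 ×ˢ tsupport φ) := by
      refine hGc.comp (by fun_prop) ?_
      rintro ⟨a, b⟩ ⟨ha, -⟩
      simpa using ha.1
    obtain ⟨D, hD⟩ := hK.exists_bound_of_continuousOn hGK
    refine tendsto_integral_filter_of_dominated_convergence (fun t => ‖φ t‖ * D) ?_ ?_
      (φ.integrable.norm.mul_const D) (.of_forall fun t => ?_)
    · filter_upwards [hIoc] with σ hσ
      refine Continuous.aestronglyMeasurable ?_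
      refine (φ.continuous.mul ?_).mul (by fun_prop)
      refine hGc.comp_continuous (by fun_prop) fun t => ?_
      simpa using hσ.1.le
    · filter_upwards [hIoc] with σ hσ
      refine .of_forall fun t => ?_
      rw [norm_mul, norm_mul, Complex.norm_exp_ofReal_mul_I, mul_one]
      by_cases ht : t ∈ tsupport φ
      · gcongr
        exact hD (σ, t) ⟨⟨hσ.1.le, hσ.2⟩, ht⟩
      · simp [image_eq_zero_of_notMem_tsupport ht]
    · refine (Tendsto.const_mul _ ?_).mul_const _
      have h0 : ContinuousWithinAt G {s | 0 ≤ s.re} ((2 * Real.pi * l * t : ℝ) * I) :=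
        hGc _ (by simp)
      refine h0.tendsto.comp (tendsto_nhdsWithin_iff.mpr ⟨?_, ?_⟩)
      · have : Continuous fun σ : ℝ => (σ : ℂ) + (2 * Real.pi * l * t : ℝ) * I := by fun_prop
        simpa using (this.tendsto 0).mono_left nhdsWithin_le_nhds
      · filter_upwards [hIoc] with σ hσ
        simpa using hσ.1.le
  have hR : Tendsto (fun σ : ℝ => ∫ u in Set.Ioi (0 : ℝ),
      Real.exp (-σ * u) * (F u * 𝓕 (φ : ℝ → ℂ) (l * (u - y)))) (𝓝[>] 0)
      (𝓝 (∫ u in Set.Ioi (0 : ℝ), F u * 𝓕 (φ : ℝ → ℂ) (l * (u - y)))) := by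
    have hi := integrableOn_fourier_smoothing φ hF hB hl y
    refine tendsto_integral_filter_of_dominated_convergence _ ?_ ?_ hi.norm
      (.of_forall fun u => ?_)
    · refine .of_forall fun σ => ?_
      exact (Continuous.aestronglyMeasurable (by fun_prop)).mul hi.1
    · filter_upwards [hIoc] with σ hσ
      filter_upwards [ae_restrict_mem measurableSet_Ioi] with u hu
      rw [norm_mul, Complex.norm_real, Real.norm_of_nonneg (Real.exp_pos _).le]
      refine mul_le_of_le_one_left (norm_nonneg _) (Real.exp_le_one_iff.mpr ?_)
      have : (0 : ℝ) < u := hu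
      nlinarith [hσ.1]
    · have : Continuous fun σ : ℝ => (Real.exp (-σ * u) : ℂ) *
          (F u * 𝓕 (φ : ℝ → ℂ) (l * (u - y))) := by fun_prop
      simpa using (this.tendsto 0).mono_left nhdsWithin_le_nhds
  refine tendsto_nhds_unique (hL.congr' ?_) hR
  filter_upwards [hIoc] with σ hσ
  exact laplace_smoothing_identity φ hF hB hG y hσ.1

lemma norm_sub_smoothing_le (φ : SchwartzMap ℝ ℂ) (hφ0 : φ 0 = 1) (hB : ∀ u, 0 ≤ u → ‖F u‖ ≤ B)
    (hL : ∀ u v, 0 ≤ u → u ≤ v → v ≤ u + 1 → ‖F v - F u‖ ≤ C * (v - u))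
    {l : ℝ} (hl : 0 < l) {y : ℝ} (hy : 1 < y) :
    ‖F y - l * ∫ u in Set.Ioi (0 : ℝ), F u * 𝓕 (φ : ℝ → ℂ) (l * (u - y))‖ ≤
      (C + 2 * B) * (∫ v : ℝ, ‖v‖ ^ 1 * ‖𝓕 (φ : ℝ → ℂ) v‖) / l := by
  have hC : 0 ≤ C := by simpa using (norm_nonneg _).trans (hL 0 1 le_rfl zero_le_one (by simp))
  have hB0 : 0 ≤ B := (norm_nonneg _).trans (hB 0 le_rfl)
  set Φ : ℝ → ℂ := 𝓕 (φ : ℝ → ℂ) with hΦdef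
  have hΦ : Integrable Φ := by
    rw [hΦdef, ← SchwartzMap.fourier_coe]; exact SchwartzMap.integrable _
  have hΦ1 : Integrable fun v : ℝ => ‖v‖ ^ 1 * ‖Φ v‖ := by
    rw [hΦdef, ← SchwartzMap.fourier_coe]; exact SchwartzMap.integrable_pow_mul _ _ 1
  set H : ℝ → ℂ := (Set.Ioi (0 : ℝ)).indicator F
  have hFc := continuousOn_of_local_lipschitz hL
  have hHB : ∀ u, ‖H u‖ ≤ B := fun u => by
    by_cases hu : u ∈ Set.Ioi (0 : ℝ)
    · simpa [H, hu] using hB u (le_of_lt hu)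
    · simpa [H, hu] using hB0
  have hHm : AEStronglyMeasurable H :=
    (aestronglyMeasurable_indicator_iff measurableSet_Ioi).mpr
      (hFc.aestronglyMeasurable measurableSet_Ioi)
  have hchange : (l : ℂ) * ∫ u in Set.Ioi (0 : ℝ), F u * Φ (l * (u - y)) =
      ∫ v : ℝ, H (l⁻¹ * v + y) * Φ v := by
    have h1 : ∫ u in Set.Ioi (0 : ℝ), F u * Φ (l * (u - y)) =
        ∫ u : ℝ, H u * Φ (l * (u - y)) := by
      rw [← integral_indicator measurableSet_Ioi]
      refine integral_congr_ae (.of_forall fun u => ?_)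
      by_cases hu : u ∈ Set.Ioi (0 : ℝ) <;> simp [H, hu]
    rw [h1, ← integral_add_right_eq_self _ y]
    have h2 := Measure.integral_comp_mul_left (fun v : ℝ => H (l⁻¹ * v + y) * Φ v) l
    rw [abs_of_pos (inv_pos.mpr hl)] at h2
    have h3 : ∀ x : ℝ, l⁻¹ * (l * x) = x := fun x => by field_simp
    simp only [h3] at h2
    simp only [add_sub_cancel_right]
    rw [h2, Complex.real_smul, ← mul_assoc, ← Complex.ofReal_mul, mul_inv_cancel₀ hl.ne']
    simp
  have hHi : Integrable fun v : ℝ => H (l⁻¹ * v + y) * Φ v := by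
    refine Integrable.bdd_mul (c := B) hΦ ?_ (.of_forall fun v => hHB _)
    have hq : Measure.QuasiMeasurePreserving (fun v : ℝ => l⁻¹ * v + y) :=
      (measurePreserving_add_right volume y).quasiMeasurePreserving.comp
        ⟨by fun_prop, by
          rw [Real.map_volume_mul_left (inv_ne_zero hl.ne')]
          exact Measure.smul_absolutelyContinuous⟩
    exact hHm.comp_quasiMeasurePreserving hq
  have hFy : F y = ∫ v : ℝ, F y * Φ v := by
    rw [integral_const_mul, integral_fourier_schwartzMap, hφ0, mul_one]
  rw [hchange, hFy, ← integral_sub (hΦ.const_mul _) hHi, ← integral_const_mul, ← integral_div]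
  refine norm_integral_le_of_norm_le ((hΦ1.const_mul _).div_const _) (.of_forall fun v => ?_)
  rw [← sub_mul, norm_mul]
  have key : ‖F y - H (l⁻¹ * v + y)‖ ≤ (C + 2 * B) * (|v| / l) := by
    rcases le_or_gt (|v| / l) 1 with h | h
    · have habs : |l⁻¹ * v| = |v| / l := by
        rw [abs_mul, abs_of_pos (inv_pos.mpr hl), div_eq_inv_mul]
      have hle := habs ▸ h
      have hpos : l⁻¹ * v + y ∈ Set.Ioi (0 : ℝ) := by
        have := neg_le_of_abs_le hle
        simp only [Set.mem_Ioi]; linarith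
      have hHF : H (l⁻¹ * v + y) = F (l⁻¹ * v + y) := Set.indicator_of_mem hpos _
      rw [hHF, ← habs]
      have hle' := abs_le.mp hle
      have : ‖F y - F (l⁻¹ * v + y)‖ ≤ C * |l⁻¹ * v| := by
        rcases le_total 0 (l⁻¹ * v) with h0 | h0
        · rw [norm_sub_rev, abs_of_nonneg h0]
          refine (hL y (l⁻¹ * v + y) (by linarith) (by linarith) (by linarith)).trans_eq (by ring)
        · rw [abs_of_nonpos h0]
          refine (hL (l⁻¹ * v + y) y (le_of_lt hpos) (by linarith) (by linarith)).trans_eq (by ring)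
      nlinarith [abs_nonneg (l⁻¹ * v)]
    · have : ‖F y - H (l⁻¹ * v + y)‖ ≤ B + B :=
        (norm_sub_le _ _).trans (add_le_add (hB y (by linarith)) (hHB _))
      nlinarith
  calc _ ≤ (C + 2 * B) * (|v| / l) * ‖Φ v‖ := by gcongr
    _ = _ := by rw [pow_one, Real.norm_eq_abs]; ring

/-- A bounded, locally uniformly Lipschitz function whose Laplace transform extends continuously to
the closed right half-plane tends to zero. -/
theorem tendsto_zero_of_laplace_continuousOn (hB : ∀ u, 0 ≤ u → ‖F u‖ ≤ B)
    (hL : ∀ u v, 0 ≤ u → u ≤ v → v ≤ u + 1 → ‖F v - F u‖ ≤ C * (v - u))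
    (hGc : ContinuousOn G {s | 0 ≤ s.re})
    (hG : ∀ s : ℂ, 0 < s.re → ∫ u in Set.Ioi (0 : ℝ), F u * cexp (-s * u) = G s) :
    Tendsto F atTop (𝓝 0) := by
  obtain ⟨φ, hφ, hφ0⟩ := exists_schwartzMap_compact_support_apply_zero
  have hFc := continuousOn_of_local_lipschitz hL
  rw [Metric.tendsto_atTop]
  intro ε hε
  set K := (C + 2 * B) * (∫ v : ℝ, ‖v‖ ^ 1 * ‖𝓕 (φ : ℝ → ℂ) v‖) with hK
  set l : ℝ := 2 * (|K| + 1) / ε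
  have hl : 0 < l := by positivity
  have hsm : ∀ y : ℝ, ∫ u in Set.Ioi (0 : ℝ), F u * 𝓕 (φ : ℝ → ℂ) (l * (u - y)) =
      𝓕 (fun t : ℝ => φ t * G ((2 * Real.pi * l * t : ℝ) * I)) (-l * y) := fun y => by
    rw [← laplace_smoothing_boundary_identity φ hφ hFc hB hGc hG hl y,
      Real.fourier_real_eq_integral_exp_smul]
    refine integral_congr_ae (.of_forall fun t => ?_)
    simp only [smul_eq_mul]
    rw [mul_comm]
    congr 3
    push_cast; ring
  have hRL := (Real.zero_at_infty_fourier
    (fun t : ℝ => φ t * G ((2 * Real.pi * l * t : ℝ) * I))).comp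
      ((tendsto_id.const_mul_atTop_of_neg (neg_lt_zero.mpr hl)).mono_right atBot_le_cocompact)
  have hRL' := (hRL.const_mul (l : ℂ)).norm
  rw [mul_zero, norm_zero] at hRL'
  have hev := (hRL'.eventually (gt_mem_nhds (half_pos hε))).and (eventually_gt_atTop (1 : ℝ))
  obtain ⟨N, hN⟩ := hev.exists_forall_of_atTop
  refine ⟨N, fun y hy => ?_⟩
  obtain ⟨h1, h2⟩ := hN y hy
  rw [dist_zero_right]
  have h3 := norm_sub_smoothing_le φ hφ0 hB hL hl h2
  rw [hsm y] at h3
  simp only [Function.comp_apply, id] at h1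
  have h4 : K / l < ε / 2 := by
    rw [div_lt_iff₀ hl]
    have : ε / 2 * l = |K| + 1 := by simp only [l]; field_simp
    rw [this]; linarith [le_abs_self K]
  calc ‖F y‖ ≤ ‖F y - l * 𝓕 (fun t : ℝ => φ t * G ((2 * Real.pi * l * t : ℝ) * I)) (-l * y)‖ +
        ‖l * 𝓕 (fun t : ℝ => φ t * G ((2 * Real.pi * l * t : ℝ) * I)) (-l * y)‖ := by
        simpa using norm_add_le (F y - l * 𝓕 (fun t : ℝ => φ t *
          G ((2 * Real.pi * l * t : ℝ) * I)) (-l * y)) (l * 𝓕 (fun t : ℝ => φ t *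
          G ((2 * Real.pi * l * t : ℝ) * I)) (-l * y))
    _ < ε := by linarith

end Tauberian

section MoebiusLogSum

open ArithmeticFunction
open scoped ArithmeticFunction.Moebius ArithmeticFunction.zeta

/-- The sum `∑_{m ≤ x} μ(m) log(x / m) / m`. -/
def moebiusLogSum (x : ℝ) : ℝ := ∑ m ∈ Ioc 0 ⌊x⌋₊, (μ m : ℝ) / m * Real.log (x / m)

lemma abs_moebius_real_le_one (n : ℕ) : |(μ n : ℝ)| ≤ 1 := by
  exact_mod_cast abs_moebius_le_one (n := n)

lemma abs_sum_moebius_div_le (N : ℕ) : |∑ n ∈ Ioc 0 N, (μ n : ℝ) / n| ≤ 2 := by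
  rcases Nat.eq_zero_or_pos N with rfl | hN
  · simp
  have hN' : (1 : ℝ) ≤ N := by exact_mod_cast hN
  have h1 : ∑ n ∈ Ioc 0 N, (μ n : ℝ) * (N / n : ℕ) = 1 := by
    have h := sum_Ioc_mul_zeta_eq_sum (μ : ArithmeticFunction ℤ) N
    rw [moebius_mul_coe_zeta, ← Finset.sum_subset (s₁ := {1}) (by simpa using by omega)
      (fun x _ hx => one_apply_ne (by simpa using hx))] at h
    simp only [sum_singleton, one_one] at h
    have h' := congrArg (Int.cast : ℤ → ℝ) h.symm
    push_cast at h'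
    exact h'
  have h2 : N * ∑ n ∈ Ioc 0 N, (μ n : ℝ) / n =
      1 + ∑ n ∈ Ioc 0 N, (μ n : ℝ) * ((N : ℝ) / n - (N / n : ℕ)) := by
    rw [← h1, ← sum_add_distrib, mul_sum]
    exact sum_congr rfl fun n _ => by ring
  have h3 : |∑ n ∈ Ioc 0 N, (μ n : ℝ) * ((N : ℝ) / n - (N / n : ℕ))| ≤ N := by
    refine (abs_sum_le_sum_abs _ _).trans ?_
    calc _ ≤ ∑ n ∈ Ioc 0 N, (1 : ℝ) := sum_le_sum fun n hn => by
          rw [abs_mul]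
          have ha : ((N / n : ℕ) : ℝ) ≤ (N : ℝ) / n := Nat.cast_div_le
          have hb : (N : ℝ) / n < (N / n : ℕ) + 1 := by
            rw [← Nat.floor_div_eq_div (K := ℝ)]; exact Nat.lt_floor_add_one _
          have hc : |(N : ℝ) / n - (N / n : ℕ)| ≤ 1 := by rw [abs_le]; constructor <;> linarith
          exact mul_le_one₀ (abs_moebius_real_le_one n) (abs_nonneg _) hc
      _ = N := by simp
  have h4 : N * |∑ n ∈ Ioc 0 N, (μ n : ℝ) / n| ≤ N * 2 := by
    rw [← abs_of_nonneg (Nat.cast_nonneg N : (0 : ℝ) ≤ N), ← abs_mul, abs_of_nonneg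
      (Nat.cast_nonneg N : (0 : ℝ) ≤ N), h2]
    refine (abs_add_le _ _).trans ?_
    rw [abs_one]; linarith
  exact le_of_mul_le_mul_left h4 (by linarith)

lemma sum_moebius_div_mul_harmonic {N : ℕ} (hN : 0 < N) :
    ∑ n ∈ Ioc 0 N, (μ n : ℝ) / n * (harmonic (N / n) : ℝ) = 1 := by
  let f : ArithmeticFunction ℝ := ⟨fun n => (μ n : ℝ) / n, by simp⟩
  let g : ArithmeticFunction ℝ := ⟨fun n => (n : ℝ)⁻¹, by simp⟩
  have hfg : ∀ n, (f * g) n = (1 : ArithmeticFunction ℝ) n := by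
    intro n
    have h : (f * g) n = ((μ * ζ : ArithmeticFunction ℤ) n : ℝ) / n := by
      rw [mul_apply, mul_apply, Int.cast_sum, sum_div]
      refine sum_congr rfl fun x hx => ?_
      obtain ⟨hx1, hx2⟩ := Nat.mem_divisorsAntidiagonal.mp hx
      have : x.2 ≠ 0 := fun h0 => hx2 (by rw [← hx1, h0, mul_zero])
      have hxx : ((x.1 : ℝ) * x.2) = n := by exact_mod_cast hx1
      change (μ x.1 : ℝ) / x.1 * (x.2 : ℝ)⁻¹ = _
      rw [← hxx]
      simp [this]
      ring
    rw [h, moebius_mul_coe_zeta]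
    by_cases hn : n = 1 <;> simp [hn]
  have h := sum_Ioc_mul_eq_sum_sum f g N
  simp only [hfg] at h
  rw [← Finset.sum_subset (s₁ := {1}) (by simpa using by omega)
      (fun x _ hx => one_apply_ne (by simpa using hx))] at h
  simp only [sum_singleton, one_one] at h
  rw [h]
  refine sum_congr rfl fun n _ => ?_
  rw [harmonic_eq_sum_Icc]
  push_cast
  rfl

lemma abs_log_sub_harmonic_floor_le {y : ℝ} (hy : 1 ≤ y) :
    |Real.log y - harmonic ⌊y⌋₊ + Real.eulerMascheroniConstant| ≤ 2 / y := by
  set n := ⌊y⌋₊ with hn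
  have hn1 : 1 ≤ n := Nat.floor_pos.mpr hy
  have hn1' : (1 : ℝ) ≤ n := by exact_mod_cast hn1
  have h1 : (n : ℝ) ≤ y := Nat.floor_le (by linarith)
  have h2 : y < n + 1 := Nat.lt_floor_add_one y
  have h3 := Real.eulerMascheroniSeq_lt_eulerMascheroniConstant n
  have h4 := Real.eulerMascheroniConstant_lt_eulerMascheroniSeq' n
  rw [Real.eulerMascheroniSeq] at h3
  rw [Real.eulerMascheroniSeq', if_neg (by omega)] at h4
  have h5 : Real.log n ≤ Real.log y := Real.log_le_log (by linarith) h1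
  have h6 : Real.log y ≤ Real.log (n + 1) := Real.log_le_log (by linarith) h2.le
  have h7 : Real.log (n + 1) - Real.log n ≤ 1 / n := by
    rw [← Real.log_div (by linarith) (by linarith)]
    refine (Real.log_le_sub_one_of_pos (by positivity)).trans_eq ?_
    field_simp; ring
  have h8 : (1 : ℝ) / n ≤ 2 / y := by
    rw [div_le_div_iff₀ (by linarith) (by linarith)]; linarith
  rw [abs_le]; constructor <;> linarith

lemma abs_moebiusLogSum_sub_one_le {x : ℝ} (hx : 1 ≤ x) : |moebiusLogSum x - 1| ≤ 4 := by
  have hN : 0 < ⌊x⌋₊ := Nat.floor_pos.mpr hx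
  set γ := Real.eulerMascheroniConstant
  have h1 := sum_moebius_div_mul_harmonic hN
  have h2 : moebiusLogSum x - 1 = -γ * ∑ n ∈ Ioc 0 ⌊x⌋₊, (μ n : ℝ) / n +
      ∑ n ∈ Ioc 0 ⌊x⌋₊, (μ n : ℝ) / n * (Real.log (x / n) - harmonic (⌊x⌋₊ / n) + γ) := by
    rw [moebiusLogSum, ← h1, mul_sum, ← sum_sub_distrib, ← sum_add_distrib]
    exact sum_congr rfl fun n _ => by ring
  have h3 : |∑ n ∈ Ioc 0 ⌊x⌋₊, (μ n : ℝ) / n * (Real.log (x / n) - harmonic (⌊x⌋₊ / n) + γ)| ≤ 2 := by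
    refine (abs_sum_le_sum_abs _ _).trans ?_
    calc _ ≤ ∑ n ∈ Ioc 0 ⌊x⌋₊, 2 / x := sum_le_sum fun n hn => by
          obtain ⟨hn0, hn1⟩ := mem_Ioc.mp hn
          have hn' : (0 : ℝ) < n := by exact_mod_cast hn0
          have hnx : (n : ℝ) ≤ x := (Nat.le_floor_iff (by linarith)).mp hn1
          have hy := abs_log_sub_harmonic_floor_le (y := x / n) ((one_le_div hn').mpr hnx)
          rw [Nat.floor_div_natCast] at hy
          rw [abs_mul, abs_div, abs_of_pos hn']
          calc _ ≤ 1 / (n : ℝ) * (2 / (x / n)) := by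
                gcongr
                exact abs_moebius_real_le_one n
            _ = 2 / x := by field_simp
      _ = ⌊x⌋₊ * (2 / x) := by simp
      _ ≤ x * (2 / x) := by gcongr; exact Nat.floor_le (by linarith)
      _ = 2 := by field_simp
  have h4 : |-γ * ∑ n ∈ Ioc 0 ⌊x⌋₊, (μ n : ℝ) / n| ≤ 2 := by
    have hγ1 := Real.one_half_lt_eulerMascheroniConstant
    have hγ2 := Real.eulerMascheroniConstant_lt_two_thirds
    have hm := abs_sum_moebius_div_le ⌊x⌋₊
    rw [abs_mul, abs_neg, abs_of_pos (by linarith)]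
    nlinarith [abs_nonneg (∑ n ∈ Ioc 0 ⌊x⌋₊, (μ n : ℝ) / n)]
  rw [h2]
  exact (abs_add_le _ _).trans (by linarith)

lemma sum_Ioc_inv_le_log {a b : ℕ} (ha : 0 < a) (hab : a ≤ b) :
    ∑ n ∈ Ioc a b, (n : ℝ)⁻¹ ≤ Real.log b - Real.log a := by
  have h := Real.strictAnti_eulerMascheroniSeq'.antitone hab
  rw [Real.eulerMascheroniSeq', Real.eulerMascheroniSeq', if_neg (by omega), if_neg (by omega),
    harmonic_eq_sum_Icc, harmonic_eq_sum_Icc] at h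
  push_cast at h
  have h2 := sum_Ioc_consecutive (fun n : ℕ => (n : ℝ)⁻¹) (Nat.zero_le a) hab
  change ∑ i ∈ Icc 1 b, (i : ℝ)⁻¹ - _ ≤ ∑ i ∈ Icc 1 a, (i : ℝ)⁻¹ - _ at h
  have h3 : ∀ c : ℕ, Icc 1 c = Ioc 0 c := fun c => rfl
  rw [h3, h3] at h
  linarith

lemma abs_moebiusLogSum_sub_le {x y : ℝ} (hx : 1 ≤ x) (hxy : x ≤ y) :
    |moebiusLogSum y - moebiusLogSum x| ≤ Real.log (y / x) * (3 + Real.log (y / x)) := by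
  set h := Real.log (y / x) with hh
  have hx0 : 0 < x := by linarith
  have hy0 : 0 ≤ y := by linarith
  have hh0 : 0 ≤ h := Real.log_nonneg ((one_le_div hx0).mpr hxy)
  have hfl : ⌊x⌋₊ ≤ ⌊y⌋₊ := Nat.floor_mono hxy
  have hfx : 0 < ⌊x⌋₊ := Nat.floor_pos.mpr hx
  have hfx' : (1 : ℝ) ≤ ⌊x⌋₊ := by exact_mod_cast hfx
  have e1 : moebiusLogSum y - moebiusLogSum x = h * ∑ n ∈ Ioc 0 ⌊x⌋₊, (μ n : ℝ) / n +
      ∑ n ∈ Ioc ⌊x⌋₊ ⌊y⌋₊, (μ n : ℝ) / n * Real.log (y / n) := by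
    rw [moebiusLogSum, moebiusLogSum, ← sum_Ioc_consecutive _ (Nat.zero_le ⌊x⌋₊) hfl,
      add_sub_right_comm, ← sum_sub_distrib, mul_sum]
    congr 1
    refine sum_congr rfl fun n hn => ?_
    have hn' : (n : ℝ) ≠ 0 := by have := (mem_Ioc.mp hn).1; positivity
    rw [hh, Real.log_div (by linarith) hn', Real.log_div (by linarith) hn',
      Real.log_div (by linarith) (by linarith)]
    ring
  have e2 : |∑ n ∈ Ioc ⌊x⌋₊ ⌊y⌋₊, (μ n : ℝ) / n * Real.log (y / n)| ≤ h * (h + 1) := by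
    refine (abs_sum_le_sum_abs _ _).trans ?_
    calc _ ≤ ∑ n ∈ Ioc ⌊x⌋₊ ⌊y⌋₊, h * (n : ℝ)⁻¹ := sum_le_sum fun n hn => by
          obtain ⟨hn0, hn1⟩ := mem_Ioc.mp hn
          have hxn : x < n := (Nat.floor_lt hx0.le).mp hn0
          have hny : (n : ℝ) ≤ y := (Nat.le_floor_iff (by linarith)).mp hn1
          have hl0 : 0 ≤ Real.log (y / n) := Real.log_nonneg ((one_le_div (by linarith)).mpr hny)
          have hl1 : Real.log (y / n) ≤ h :=
            Real.log_le_log (div_pos (by linarith) (by linarith)) (by gcongr)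
          rw [abs_mul, abs_div, abs_of_pos (by linarith : (0 : ℝ) < n), abs_of_nonneg hl0,
            mul_comm, ← one_div]
          gcongr
          exact abs_moebius_real_le_one n
      _ = h * ∑ n ∈ Ioc ⌊x⌋₊ ⌊y⌋₊, (n : ℝ)⁻¹ := (mul_sum _ _ _).symm
      _ ≤ h * (h + 1) := by
          gcongr
          refine (sum_Ioc_inv_le_log hfx hfl).trans ?_
          have a1 : Real.log ⌊y⌋₊ ≤ Real.log y :=
            Real.log_le_log (by exact_mod_cast hfx.trans_le hfl) (Nat.floor_le (by linarith))
          have a2 : Real.log (x / 2) ≤ Real.log ⌊x⌋₊ := by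
            refine Real.log_le_log (by linarith) ?_
            have := Nat.lt_floor_add_one x
            linarith
          rw [Real.log_div (by linarith) (by norm_num)] at a2
          rw [hh, Real.log_div (by linarith) (by linarith)]
          have := Real.log_two_lt_d9
          linarith
  have e3 := abs_sum_moebius_div_le ⌊x⌋₊
  rw [e1]
  refine (abs_add_le _ _).trans ?_
  rw [abs_mul, abs_of_nonneg hh0]
  nlinarith

end MoebiusLogSum

section MoebiusLaplace

open MeasureTheory Topology Complex ArithmeticFunction
open scoped ArithmeticFunction.Moebius ArithmeticFunction.zeta

lemma tendsto_sub_mul_exp_neg (c b : ℝ) {σ : ℝ} (hσ : 0 < σ) :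
    Tendsto (fun u : ℝ => ((u - c) * b + b ^ 2) * Real.exp (-σ * u)) atTop (𝓝 0) := by
  have h1 := (Real.tendsto_pow_mul_exp_neg_atTop_nhds_zero 1).comp
    (tendsto_id.const_mul_atTop hσ)
  have h0 := (Real.tendsto_pow_mul_exp_neg_atTop_nhds_zero 0).comp
    (tendsto_id.const_mul_atTop hσ)
  have h := (h1.const_mul (σ⁻¹ * b)).add (h0.const_mul (b ^ 2 - c * b))
  simp only [mul_zero, add_zero] at h
  refine h.congr fun u => ?_
  simp only [Function.comp_apply, id, pow_one, pow_zero, neg_mul]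
  field_simp
  ring

lemma hasDerivAt_laplace_ramp {s : ℂ} (hs : s ≠ 0) (c u : ℝ) :
    HasDerivAt (fun u : ℝ => -(((u - c : ℝ) : ℂ) * s⁻¹ + s⁻¹ ^ 2) * cexp (-s * u))
      (((u - c : ℝ) : ℂ) * cexp (-s * u)) u := by
  have h1 : HasDerivAt (fun u : ℝ => ((u - c : ℝ) : ℂ)) 1 u := by
    simpa using ((hasDerivAt_id u).sub_const c).ofReal_comp
  have h2 : HasDerivAt (fun u : ℝ => cexp (-s * u)) (cexp (-s * u) * (-s)) u := by
    have h3 : HasDerivAt (fun u : ℝ => (u : ℂ)) 1 u := by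
      simpa using (hasDerivAt_id u).ofReal_comp
    simpa using (h3.const_mul (-s)).cexp
  convert! ((h1.mul_const s⁻¹).add_const (s⁻¹ ^ 2)).neg.mul h2 using 1
  simp only [Pi.neg_apply]
  field_simp
  ring

lemma integrableOn_laplace_ramp (c : ℝ) {σ : ℝ} (hσ : 0 < σ) :
    IntegrableOn (fun u : ℝ => (u - c) * Real.exp (-σ * u)) (Set.Ioi c) ∧
      ∫ u in Set.Ioi c, (u - c) * Real.exp (-σ * u) = Real.exp (-σ * c) / σ ^ 2 := by
  have hd : ∀ u : ℝ, HasDerivAt (fun u : ℝ => -((u - c) * σ⁻¹ + σ⁻¹ ^ 2) * Real.exp (-σ * u))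
      ((u - c) * Real.exp (-σ * u)) u := fun u => by
    have h2 : HasDerivAt (fun u : ℝ => Real.exp (-σ * u)) (Real.exp (-σ * u) * (-σ)) u := by
      simpa using ((hasDerivAt_id u).const_mul (-σ)).exp
    convert! ((((hasDerivAt_id u).sub_const c).mul_const σ⁻¹).add_const (σ⁻¹ ^ 2)).neg.mul h2
      using 1
    simp only [id, Pi.neg_apply]
    field_simp
    ring
  have hnn : ∀ u ∈ Set.Ioi c, 0 ≤ (u - c) * Real.exp (-σ * u) := fun u hu =>
    mul_nonneg (sub_nonneg.mpr (le_of_lt hu)) (Real.exp_pos _).le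
  have ht : Tendsto (fun u : ℝ => -((u - c) * σ⁻¹ + σ⁻¹ ^ 2) * Real.exp (-σ * u)) atTop (𝓝 0) := by
    have h := (tendsto_sub_mul_exp_neg c σ⁻¹ hσ).neg
    rw [neg_zero] at h
    exact h.congr fun u => by ring
  refine ⟨integrableOn_Ioi_deriv_of_nonneg' (fun u _ => hd u) hnn ht, ?_⟩
  rw [integral_Ioi_of_hasDerivAt_of_nonneg' (fun u _ => hd u) hnn ht]
  simp [div_eq_mul_inv, mul_comm]

lemma norm_laplace_ramp {s : ℂ} {c u : ℝ} (hu : c < u) :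
    ‖((u - c : ℝ) : ℂ) * cexp (-s * u)‖ = (u - c) * Real.exp (-s.re * u) := by
  rw [norm_mul, Complex.norm_real, Real.norm_of_nonneg (by linarith), Complex.norm_exp]
  simp

lemma integrableOn_laplace_ramp_complex (c : ℝ) {s : ℂ} (hs : 0 < s.re) :
    IntegrableOn (fun u : ℝ => ((u - c : ℝ) : ℂ) * cexp (-s * u)) (Set.Ioi c) := by
  refine (integrableOn_laplace_ramp c hs).1.mono' ?_ ?_
  · exact Continuous.aestronglyMeasurable (by fun_prop)
  · filter_upwards [ae_restrict_mem measurableSet_Ioi] with u hu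
    exact (norm_laplace_ramp hu).le

lemma integral_laplace_ramp (c : ℝ) {s : ℂ} (hs : 0 < s.re) :
    ∫ u in Set.Ioi c, ((u - c : ℝ) : ℂ) * cexp (-s * u) = cexp (-s * c) / s ^ 2 := by
  have hs0 : s ≠ 0 := fun h => by simp [h] at hs
  have ht : Tendsto (fun u : ℝ => -(((u - c : ℝ) : ℂ) * s⁻¹ + s⁻¹ ^ 2) * cexp (-s * u)) atTop
      (𝓝 0) := by
    refine squeeze_zero_norm' ?_ (tendsto_sub_mul_exp_neg c ‖s‖⁻¹ hs)
    filter_upwards [eventually_ge_atTop c] with u hu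
    rw [norm_mul, norm_neg, Complex.norm_exp]
    have : (-s * (u : ℂ)).re = -s.re * u := by simp
    rw [this]
    gcongr
    refine (norm_add_le _ _).trans_eq ?_
    rw [norm_mul, norm_pow, norm_inv, Complex.norm_real, Real.norm_of_nonneg (by linarith)]
  rw [integral_Ioi_of_hasDerivAt_of_tendsto' (fun u _ => hasDerivAt_laplace_ramp hs0 c u)
    (integrableOn_laplace_ramp_complex c hs) ht]
  simp [div_eq_mul_inv, mul_comm]

/-- The Laplace transform of `u ↦ ∑_{m ≤ e^u} μ(m) log(e^u / m) / m`. -/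
lemma laplace_moebiusLogSum {s : ℂ} (hs : 0 < s.re) :
    ∫ u in Set.Ioi (0 : ℝ), (moebiusLogSum (Real.exp u) : ℂ) * cexp (-s * u) =
      (s ^ 2 * riemannZeta (1 + s))⁻¹ := by
  have h1s : 1 < (1 + s).re := by simpa using hs
  let Fm : ℕ → ℝ → ℂ := fun m => (Set.Ioi (Real.log m)).indicator
    (fun u => (μ m : ℂ) / m * (((u - Real.log m : ℝ) : ℂ) * cexp (-s * u)))
  have hsub : ∀ m : ℕ, Set.Ioi (0 : ℝ) ∩ Set.Ioi (Real.log m) = Set.Ioi (Real.log m) := fun m =>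
    Set.inter_eq_right.mpr (Set.Ioi_subset_Ioi (Real.log_natCast_nonneg m))
  have hterm : ∀ m : ℕ, (μ m : ℂ) / m * cexp (-s * Real.log m) =
      LSeries.term (fun n => (μ n : ℂ)) (1 + s) m := fun m => by
    rcases Nat.eq_zero_or_pos m with rfl | hm
    · simp
    have hm' : (m : ℂ) ≠ 0 := by exact_mod_cast hm.ne'
    rw [LSeries.term_of_ne_zero hm.ne', Complex.cpow_add _ _ hm', Complex.cpow_one,
      Complex.cpow_def_of_ne_zero hm', ← Complex.natCast_log, neg_mul, Complex.exp_neg,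
      mul_comm s]
    field_simp
  have h_int : ∀ m, ∫ u in Set.Ioi (0 : ℝ), Fm m u =
      LSeries.term (fun n => (μ n : ℂ)) (1 + s) m / s ^ 2 := fun m => by
    rw [setIntegral_indicator measurableSet_Ioi, hsub, integral_const_mul,
      integral_laplace_ramp _ hs, ← hterm, mul_div_assoc]
  have hnorm : ∀ m, ∫ u in Set.Ioi (0 : ℝ), ‖Fm m u‖ =
      ‖LSeries.term (fun n => (μ n : ℂ)) (1 + s) m‖ / s.re ^ 2 := fun m => by
    have : ∀ u, ‖Fm m u‖ = (Set.Ioi (Real.log m)).indicator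
        (fun u => ‖(μ m : ℂ) / m‖ * ‖((u - Real.log m : ℝ) : ℂ) * cexp (-s * u)‖) u := fun u => by
      simp only [Fm, norm_indicator_eq_indicator_norm, norm_mul]
    have hexp : ‖cexp (-s * (Real.log m : ℂ))‖ = Real.exp (-s.re * Real.log m) := by
      rw [Complex.norm_exp]
      simp only [mul_re, neg_re, ofReal_re, ofReal_im, mul_zero, sub_zero]
    simp only [this]
    rw [setIntegral_indicator measurableSet_Ioi, hsub, integral_const_mul,
      setIntegral_congr_fun measurableSet_Ioi (fun u hu => norm_laplace_ramp hu),
      (integrableOn_laplace_ramp _ hs).2, ← hterm, norm_mul, hexp, mul_div_assoc]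
  have hFi : ∀ m, Integrable (Fm m) (volume.restrict (Set.Ioi (0 : ℝ))) := fun m => by
    refine Integrable.mono_measure ?_ Measure.restrict_le_self
    rw [integrable_indicator_iff measurableSet_Ioi]
    exact (integrableOn_laplace_ramp_complex _ hs).const_mul _
  have hsum : Summable fun m => ∫ u in Set.Ioi (0 : ℝ), ‖Fm m u‖ := by
    simp only [hnorm]
    exact (LSeriesSummable_moebius_iff.mpr h1s).norm.div_const _
  have hS := hasSum_integral_of_summable_integral_norm hFi hsum
  simp only [h_int] at hS
  have hL := ((LSeriesSummable_moebius_iff.mpr h1s).LSeriesHasSum).div_const (s ^ 2)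
  have hval : LSeries (fun n => (μ n : ℂ)) (1 + s) = (riemannZeta (1 + s))⁻¹ := by
    have := LSeries_zeta_mul_Lseries_moebius h1s
    rw [LSeries_zeta_eq_riemannZeta h1s] at this
    exact eq_inv_of_mul_eq_one_right this
  have hT : ∀ u ∈ Set.Ioi (0 : ℝ), (moebiusLogSum (Real.exp u) : ℂ) * cexp (-s * u) =
      ∑' m, Fm m u := fun u hu => by
    rw [tsum_eq_sum (s := Ioc 0 ⌊Real.exp u⌋₊), moebiusLogSum, Complex.ofReal_sum, sum_mul]
    · refine sum_congr rfl fun m hm => ?_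
      obtain ⟨hm0, hm1⟩ := mem_Ioc.mp hm
      have hm0' : (0 : ℝ) < m := by exact_mod_cast hm0
      have hmu : (m : ℝ) ≤ Real.exp u := (Nat.le_floor_iff (Real.exp_pos u).le).mp hm1
      have hlog : Real.log m ≤ u := (Real.log_le_iff_le_exp hm0').mpr hmu
      rw [Real.log_div (Real.exp_pos u).ne' hm0'.ne', Real.log_exp]
      rcases hlog.eq_or_lt with h | h
      · simp [Fm, h]
      · simp only [Fm, Set.indicator_of_mem (Set.mem_Ioi.mpr h)]
        push_cast
        ring
    · intro m hm
      rcases Nat.eq_zero_or_pos m with rfl | hm0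
      · simp [Fm]
      · have hm0' : (0 : ℝ) < m := by exact_mod_cast hm0
        refine Set.indicator_of_notMem (fun h => hm (mem_Ioc.mpr ⟨hm0, ?_⟩)) _
        rw [Nat.le_floor_iff (Real.exp_pos u).le]
        exact ((Real.log_lt_iff_lt_exp hm0').mp h).le
  rw [setIntegral_congr_fun measurableSet_Ioi hT, hS.unique hL, hval, mul_inv, div_eq_mul_inv,
    mul_comm]

/-- The entire function `s ↦ s ζ(1 + s)`. -/
def zetaShift : ℂ → ℂ := Function.update (fun s => s * riemannZeta (1 + s)) 0 1

lemma differentiable_zetaShift : Differentiable ℂ zetaShift := by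
  rw [← differentiableOn_univ,
    ← Complex.differentiableOn_compl_singleton_and_continuousAt_iff (c := 0) Filter.univ_mem]
  refine ⟨fun s hs => ?_, ?_⟩
  · have hs0 : s ≠ 0 := by simpa using hs.2
    have h1 : DifferentiableAt ℂ (fun s => s * riemannZeta (1 + s)) s := by
      refine differentiableAt_id.mul (DifferentiableAt.comp s
        (differentiableAt_riemannZeta (by simpa using hs0)) (by fun_prop))
    refine (h1.congr_of_eventuallyEq ?_).differentiableWithinAt
    filter_upwards [isOpen_ne.mem_nhds hs0] with z hz
    exact Function.update_of_ne hz _ _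
  · rw [zetaShift, continuousAt_update_same]
    have h : Tendsto (fun s : ℂ => 1 + s) (𝓝[≠] 0) (𝓝[≠] 1) := by
      refine tendsto_nhdsWithin_iff.mpr ⟨?_, ?_⟩
      · have : Continuous fun s : ℂ => 1 + s := by fun_prop
        simpa using (this.tendsto 0).mono_left nhdsWithin_le_nhds
      · filter_upwards [self_mem_nhdsWithin] with s hs
        simpa using hs
    simpa [Function.comp_def] using riemannZeta_residue_one.comp h

lemma zetaShift_ne_zero {s : ℂ} (hs : 0 ≤ s.re) : zetaShift s ≠ 0 := by
  by_cases h : s = 0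
  · simp [zetaShift, h]
  · rw [zetaShift, Function.update_of_ne h]
    exact mul_ne_zero h (riemannZeta_ne_zero_of_one_le_re (by simpa using hs))

/-- A form of the prime number theorem. -/
theorem tendsto_moebiusLogSum : Tendsto moebiusLogSum atTop (𝓝 1) := by
  let F : ℝ → ℂ := fun u => (moebiusLogSum (Real.exp u) : ℂ) - 1
  let g : ℂ → ℂ := fun s => (zetaShift s)⁻¹
  have hg : ∀ s : ℂ, 0 ≤ s.re → DifferentiableAt ℂ g s := fun s hs =>
    (differentiable_zetaShift s).inv (zetaShift_ne_zero hs)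
  have hB : ∀ u, 0 ≤ u → ‖F u‖ ≤ 4 := fun u hu => by
    have := abs_moebiusLogSum_sub_one_le (Real.one_le_exp hu)
    rw [← Real.norm_eq_abs, ← Complex.norm_real] at this
    simpa [F] using this
  have hL : ∀ u v, 0 ≤ u → u ≤ v → v ≤ u + 1 → ‖F v - F u‖ ≤ 4 * (v - u) := fun u v hu huv hv => by
    have := abs_moebiusLogSum_sub_le (Real.one_le_exp hu) (Real.exp_le_exp.mpr huv)
    rw [← Real.exp_sub, Real.log_exp, ← Real.norm_eq_abs, ← Complex.norm_real] at this
    simp only [F, sub_sub_sub_cancel_right]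
    push_cast at this
    refine this.trans ?_
    nlinarith
  have hGc : ContinuousOn (dslope g 0) {s | 0 ≤ s.re} := fun s hs => by
    apply ContinuousAt.continuousWithinAt
    by_cases h : s = 0
    · rw [h]
      exact continuousAt_dslope_same.mpr (hg 0 (by simp))
    · exact (continuousAt_dslope_of_ne h).mpr (hg s hs).continuousAt
  have hG : ∀ s : ℂ, 0 < s.re →
      ∫ u in Set.Ioi (0 : ℝ), F u * cexp (-s * u) = dslope g 0 s := fun s hs => by
    have hs0 : s ≠ 0 := fun h => by simp [h] at hs
    have hneg : (-s).re < 0 := by simpa using hs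
    have hi1 : IntegrableOn (fun u : ℝ => cexp (-s * u)) (Set.Ioi 0) :=
      integrableOn_exp_mul_complex_Ioi hneg 0
    have hi2 : IntegrableOn (fun u : ℝ => F u * cexp (-s * u)) (Set.Ioi 0) := by
      refine Integrable.bdd_mul (c := 4) hi1
        ((continuousOn_of_local_lipschitz hL).aestronglyMeasurable measurableSet_Ioi) ?_
      exact (ae_restrict_mem measurableSet_Ioi).mono fun u hu => hB u (le_of_lt hu)
    have h1 := integral_add hi2 hi1
    have h2 : ∀ u : ℝ, F u * cexp (-s * u) + cexp (-s * u) =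
        (moebiusLogSum (Real.exp u) : ℂ) * cexp (-s * u) := fun u => by simp only [F]; ring
    simp only [h2] at h1
    rw [laplace_moebiusLogSum hs, integral_exp_mul_complex_Ioi hneg] at h1
    rw [dslope_of_ne _ hs0, slope_def_field, eq_sub_of_add_eq h1.symm]
    simp only [g, zetaShift, Function.update_of_ne hs0, Function.update_self]
    have := riemannZeta_ne_zero_of_one_le_re (s := 1 + s) (by simpa using hs.le)
    simp
    field_simp
  have hF := tendsto_zero_of_laplace_continuousOn hB hL hGc hG
  have h1 : Tendsto (fun u => moebiusLogSum (Real.exp u)) atTop (𝓝 1) := by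
    have h2 := (Complex.continuous_re.tendsto _).comp (hF.add_const 1)
    simpa [F, Function.comp_def] using h2
  refine (h1.comp Real.tendsto_log_atTop).congr' ?_
  filter_upwards [eventually_gt_atTop 0] with x hx
  simp [Real.exp_log hx]

end MoebiusLaplace

section CoprimeMoebiusSum

open ArithmeticFunction Topology
open scoped ArithmeticFunction.Moebius ArithmeticFunction.zeta

lemma sum_Ioc_sum_divisorsAntidiagonal (F : ℕ → ℕ → ℝ) (N : ℕ) :
    ∑ n ∈ Ioc 0 N, ∑ x ∈ n.divisorsAntidiagonal, F x.1 x.2 =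
      ∑ j ∈ Ioc 0 N, ∑ m ∈ Ioc 0 (N / j), F j m := by
  trans ∑ x ∈ Ioc 0 N ×ˢ Ioc 0 N with x.1 * x.2 ≤ N, F x.1 x.2
  · trans ∑ n ∈ Ioc 0 N, ∑ x ∈ Ioc 0 N ×ˢ Ioc 0 N with x.1 * x.2 = n, F x.1 x.2
    · refine sum_congr rfl fun n hn => ?_
      simp only [mem_Ioc] at hn
      rw [Nat.divisorsAntidiagonal_eq_prod_filter_of_le hn.1.ne' hn.2]
    · simp_rw [sum_filter]
      rw [sum_comm]
      exact sum_congr rfl fun _ _ => by simp_all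
  · rw [sum_filter, sum_product]
    refine sum_congr rfl fun n hn => ?_
    rw [← sum_filter]
    refine sum_congr ?_ fun _ _ => rfl
    ext m
    simp only [mem_filter, mem_Ioc] at hn ⊢
    rw [mul_comm, ← Nat.le_div_iff_mul_le hn.1]
    have := Nat.div_le_self N n
    omega

/-- The sum `∑ μ(m) log(x / m) / m` over `m ≤ x` coprime to `q`. -/
def coprimeMoebiusLogSum (q : ℕ) (x : ℝ) : ℝ :=
  ∑ m ∈ Ioc 0 ⌊x⌋₊ with m.Coprime q, (μ m : ℝ) / m * Real.log (x / m)

/-- The integers in `[1, x]` all of whose prime factors divide `q`. -/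
def primePowersOf (q : ℕ) (x : ℝ) : Finset ℕ :=
  (Ioc 0 ⌊x⌋₊).filter fun j => j.primeFactors ⊆ q.primeFactors

lemma sum_divisorsAntidiagonal_moebius {q : ℕ} (hq : q ≠ 0) (n : ℕ) (hn : n ≠ 0) :
    ∑ x ∈ n.divisorsAntidiagonal,
        (if x.1.primeFactors ⊆ q.primeFactors then (μ x.2 : ℝ) else 0) =
      if n.Coprime q then (μ n : ℝ) else 0 := by
  let a : ArithmeticFunction ℝ :=
    ⟨fun j => if j ≠ 0 ∧ j.primeFactors ⊆ q.primeFactors then 1 else 0, by simp⟩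
  let b : ArithmeticFunction ℝ := ⟨fun j => if j.Coprime q then (μ j : ℝ) else 0, by simp⟩
  have ha : a.IsMultiplicative := by
    refine IsMultiplicative.iff_ne_zero.mpr ⟨by simp [a], fun {m n} hm hn _ => ?_⟩
    simp only [a, coe_mk, Nat.primeFactors_mul hm hn, union_subset_iff, ne_eq, mul_eq_zero, hm, hn]
    by_cases h1 : m.primeFactors ⊆ q.primeFactors <;>
      by_cases h2 : n.primeFactors ⊆ q.primeFactors <;> simp [h1, h2]
  have hb : b.IsMultiplicative := by
    refine IsMultiplicative.iff_ne_zero.mpr ⟨by simp [b], fun {m n} hm hn hmn => ?_⟩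
    simp only [b, coe_mk, Nat.coprime_mul_iff_left, isMultiplicative_moebius.map_mul_of_coprime hmn]
    rw [Int.cast_mul, ite_zero_mul_ite_zero]
  have hz : ((ζ : ArithmeticFunction ℕ) : ArithmeticFunction ℝ).IsMultiplicative :=
    isMultiplicative_zeta.natCast
  have h1 : a = b * (ζ : ArithmeticFunction ℝ) := by
    rw [IsMultiplicative.eq_iff_eq_on_prime_powers _ ha _ (hb.mul hz)]
    intro p i hp
    rw [coe_mul_zeta_apply, Nat.sum_divisors_prime_pow hp]
    rcases Nat.eq_zero_or_pos i with rfl | hi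
    · simp [a, b]
    rw [← Finset.sum_subset (s₁ := range 2) (by intro t; simp; omega)]
    · have hpd : p ∣ q ↔ ¬ p.Coprime q := by rw [hp.coprime_iff_not_dvd, not_not]
      simp only [sum_range_succ, sum_range_zero, a, b, coe_mk, pow_zero, pow_one,
        Nat.primeFactors_prime_pow hi.ne' hp, singleton_subset_iff, Nat.mem_primeFactors, hp,
        moebius_apply_prime hp, hpd]
      by_cases h : p.Coprime q
      · rw [if_pos h, if_neg (by tauto)]
        simp
      · simp only [h, if_false]
        simp [hp.ne_zero, hq]
    · intro t _ ht
      have ht' : 1 < t := by simpa using ht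
      simp [b, moebius_apply_prime_pow hp (by omega : t ≠ 0), show t ≠ 1 by omega]
  have h2 : a * ((μ : ArithmeticFunction ℤ) : ArithmeticFunction ℝ) = b := by
    rw [h1, mul_assoc, coe_zeta_mul_coe_moebius, mul_one]
  have h3 := congrArg (fun f : ArithmeticFunction ℝ => f n) h2
  simp only [mul_apply] at h3
  change _ = if n.Coprime q then (μ n : ℝ) else 0 at h3
  rw [← h3]
  refine sum_congr rfl fun x hx => ?_
  have : x.1 ≠ 0 := by
    rintro h0
    obtain ⟨hx1, -⟩ := Nat.mem_divisorsAntidiagonal.mp hx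
    exact hn (by rw [← hx1, h0, zero_mul])
  simp [a, this]

lemma coprimeMoebiusLogSum_eq {q : ℕ} (hq : q ≠ 0) {x : ℝ} :
    coprimeMoebiusLogSum q x = ∑ j ∈ primePowersOf q x, (j : ℝ)⁻¹ * moebiusLogSum (x / j) := by
  rw [coprimeMoebiusLogSum, primePowersOf, sum_filter, sum_filter]
  have h := sum_Ioc_sum_divisorsAntidiagonal (fun j m => (if j.primeFactors ⊆ q.primeFactors then
    (μ m : ℝ) else 0) * (((j * m : ℕ) : ℝ)⁻¹ * Real.log (x / (j * m : ℕ)))) ⌊x⌋₊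
  trans ∑ n ∈ Ioc 0 ⌊x⌋₊, ∑ y ∈ n.divisorsAntidiagonal,
    (if y.1.primeFactors ⊆ q.primeFactors then (μ y.2 : ℝ) else 0) *
      (((y.1 * y.2 : ℕ) : ℝ)⁻¹ * Real.log (x / (y.1 * y.2 : ℕ)))
  · refine sum_congr rfl fun n hn => ?_
    rw [sum_congr rfl (g := fun y : ℕ × ℕ => (if y.1.primeFactors ⊆ q.primeFactors then
      (μ y.2 : ℝ) else 0) * ((n : ℝ)⁻¹ * Real.log (x / n))) fun y hy => by
        rw [(Nat.mem_divisorsAntidiagonal.mp hy).1], ← sum_mul,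
      sum_divisorsAntidiagonal_moebius hq n (mem_Ioc.mp hn).1.ne']
    split_ifs
    · ring
    · simp
  · rw [h]
    refine sum_congr rfl fun j _ => ?_
    split_ifs
    · rw [moebiusLogSum, Nat.floor_div_natCast, mul_sum]
      refine sum_congr rfl fun m _ => ?_
      push_cast
      rw [mul_inv, div_div]
      ring
    · simp

lemma totient_div_self_eq (q : ℕ) (hq : q ≠ 0) :
    (q : ℝ) / q.totient = ∏ p ∈ q.primeFactors, (1 - (p : ℝ)⁻¹)⁻¹ := by
  have h : (q.totient : ℝ) = q * ∏ p ∈ q.primeFactors, (1 - (p : ℝ)⁻¹) := by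
    have h := congrArg (Rat.cast : ℚ → ℝ) (Nat.totient_eq_mul_prod_factors q)
    push_cast at h
    exact h
  have hq' : (q : ℝ) ≠ 0 := by exact_mod_cast hq
  rw [h, prod_inv_distrib, div_mul_eq_div_div, div_self hq', one_div]

lemma sum_primePowersOf_inv_le {q : ℕ} (hq : q ≠ 0) (x : ℝ) :
    ∑ j ∈ primePowersOf q x, (j : ℝ)⁻¹ ≤ q / q.totient := by
  let f : ℕ →* ℝ := ⟨⟨fun n => (n : ℝ)⁻¹, by simp⟩, fun a b => by simp [mul_comm]⟩
  have hf : ∀ {p : ℕ}, p.Prime → ‖f p‖ < 1 := fun {p} hp => by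
    have : (1 : ℝ) < p := by exact_mod_cast hp.one_lt
    change ‖(p : ℝ)⁻¹‖ < 1
    rw [norm_inv, Real.norm_natCast]
    exact inv_lt_one_of_one_lt₀ this
  have hs := (EulerProduct.summable_and_hasSum_factoredNumbers_prod_filter_prime_geometric hf
    q.primeFactors).2
  rw [filter_true_of_mem (fun p hp => Nat.prime_of_mem_primeFactors hp)] at hs
  rw [totient_div_self_eq q hq]
  let e : (primePowersOf q x) → Nat.factoredNumbers q.primeFactors := fun j => ⟨j.1, by
    obtain ⟨h1, h2⟩ := mem_filter.mp j.2
    exact Nat.mem_factoredNumbers_iff_primeFactors_subset.mpr ⟨(mem_Ioc.mp h1).1.ne', h2⟩⟩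
  have he : Function.Injective e := fun a b h =>
    Subtype.ext (congrArg (fun t : Nat.factoredNumbers q.primeFactors => (t : ℕ)) h)
  have := sum_le_hasSum (univ.map ⟨e, he⟩) (fun i _ => by
    change 0 ≤ ((i : ℕ) : ℝ)⁻¹
    positivity) hs
  rw [sum_map] at this
  rw [← sum_coe_sort]
  exact this

/-- The error term in the asymptotic for `moebiusLogSum`. -/
def moebiusLogError (y : ℝ) : ℝ := |moebiusLogSum y - 1|

lemma sq_coprimeMoebiusLogSum_le {q : ℕ} (hq : q ≠ 0) {x : ℝ} (hx : 0 ≤ x) :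
    coprimeMoebiusLogSum q x ^ 2 ≤ ((q : ℝ) / q.totient) ^ 2 + 6 * ((q : ℝ) / q.totient) *
      ∑ j ∈ primePowersOf q x, (j : ℝ)⁻¹ * moebiusLogError (x / j) := by
  set ρ := (q : ℝ) / q.totient
  set e := ∑ j ∈ primePowersOf q x, (j : ℝ)⁻¹ * moebiusLogError (x / j)
  have h1 := sum_primePowersOf_inv_le hq x
  have he0 : 0 ≤ e := sum_nonneg fun j _ => mul_nonneg (by positivity) (abs_nonneg _)
  have he : e ≤ 4 * ρ := by
    refine le_trans ?_ (mul_le_mul_of_nonneg_left h1 (by norm_num))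
    rw [mul_sum]
    refine sum_le_sum fun j hj => ?_
    obtain ⟨h2, h3⟩ := mem_Ioc.mp (mem_filter.mp hj).1
    have hj0 : (0 : ℝ) < j := by exact_mod_cast h2
    rw [mul_comm]
    exact mul_le_mul_of_nonneg_right (abs_moebiusLogSum_sub_one_le
      ((one_le_div hj0).mpr ((Nat.le_floor_iff hx).mp h3))) (by positivity)
  have hT : |coprimeMoebiusLogSum q x| ≤ ρ + e := by
    rw [coprimeMoebiusLogSum_eq hq]
    refine (abs_sum_le_sum_abs _ _).trans ?_
    refine le_trans ?_ (add_le_add_left h1 e)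
    rw [← sum_add_distrib]
    refine sum_le_sum fun j hj => ?_
    have hj0 : (0 : ℝ) ≤ (j : ℝ)⁻¹ := by positivity
    rw [abs_mul, abs_of_nonneg hj0, moebiusLogError]
    have h4 : |moebiusLogSum (x / j)| ≤ 1 + |moebiusLogSum (x / j) - 1| := by
      have := abs_add_le 1 (moebiusLogSum (x / j) - 1)
      simpa using this
    nlinarith
  have h5 := sq_le_sq' (by linarith [abs_nonneg (coprimeMoebiusLogSum q x)]) hT
  rw [sq_abs] at h5
  nlinarith

/-- The logarithmic average of the error term is small. -/
lemma sum_moebiusLogError_le {η : ℝ} (hη : 0 < η) :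
    ∃ C : ℝ, 0 ≤ C ∧ ∀ R : ℝ, 1 ≤ R →
      ∑ n ∈ Ioc 0 ⌊R⌋₊, (n : ℝ)⁻¹ * moebiusLogError (R / n) ≤ η * Real.log R + C := by
  have h := (tendsto_moebiusLogSum.sub_const 1).abs
  rw [sub_self, abs_zero] at h
  obtain ⟨Y, hY1, hY⟩ : ∃ Y : ℝ, 1 ≤ Y ∧ ∀ y ≥ Y, |moebiusLogSum y - 1| < η := by
    obtain ⟨Y, hY⟩ := eventually_atTop.mp (h.eventually_lt_const hη)
    exact ⟨max Y 1, le_max_right _ _, fun y hy => hY y ((le_max_left _ _).trans hy)⟩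
  have hlogY := Real.log_nonneg hY1
  refine ⟨η + 4 * (1 + Real.log Y), by positivity, fun R hR => ?_⟩
  have hR0 : 0 < R := by linarith
  have hfl : ⌊R / Y⌋₊ ≤ ⌊R⌋₊ := Nat.floor_mono (div_le_self hR0.le hY1)
  have hH : ∀ n : ℕ, ∑ i ∈ Ioc 0 n, (i : ℝ)⁻¹ = (harmonic n : ℝ) := fun n => by
    rw [harmonic_eq_sum_Icc]; push_cast; rfl
  have h1 : ∑ n ∈ Ioc 0 ⌊R⌋₊, (n : ℝ)⁻¹ ≤ 1 + Real.log R := by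
    rw [hH]; exact harmonic_floor_le_one_add_log R hR
  have h2 : Real.log (R / Y) ≤ ∑ n ∈ Ioc 0 ⌊R / Y⌋₊, (n : ℝ)⁻¹ := by
    rw [hH]
    refine le_trans (Real.log_le_log (by positivity) ?_) (log_add_one_le_harmonic _)
    exact_mod_cast (Nat.lt_floor_add_one (R / Y)).le
  have h3 := sum_Ioc_consecutive (fun n : ℕ => (n : ℝ)⁻¹) (Nat.zero_le _) hfl
  rw [Real.log_div hR0.ne' (by linarith)] at h2
  rw [← sum_Ioc_consecutive _ (Nat.zero_le _) hfl]
  have h4 : ∑ n ∈ Ioc 0 ⌊R / Y⌋₊, (n : ℝ)⁻¹ * moebiusLogError (R / n) ≤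
      η * ∑ n ∈ Ioc 0 ⌊R / Y⌋₊, (n : ℝ)⁻¹ := by
    rw [mul_sum]
    refine sum_le_sum fun n hn => ?_
    obtain ⟨hn0, hn1⟩ := mem_Ioc.mp hn
    have hn0' : (0 : ℝ) < n := by exact_mod_cast hn0
    have hn2 := (Nat.le_floor_iff (by positivity)).mp hn1
    rw [le_div_iff₀ (by linarith)] at hn2
    rw [mul_comm]
    exact mul_le_mul_of_nonneg_right (hY _ ((le_div_iff₀ hn0').mpr (by linarith))).le
      (by positivity)
  have h5 : ∑ n ∈ Ioc ⌊R / Y⌋₊ ⌊R⌋₊, (n : ℝ)⁻¹ * moebiusLogError (R / n) ≤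
      4 * ∑ n ∈ Ioc ⌊R / Y⌋₊ ⌊R⌋₊, (n : ℝ)⁻¹ := by
    rw [mul_sum]
    refine sum_le_sum fun n hn => ?_
    obtain ⟨hn0, hn1⟩ := mem_Ioc.mp hn
    have hn0' : (0 : ℝ) < n := by exact_mod_cast (Nat.zero_le _).trans_lt hn0
    rw [mul_comm]
    exact mul_le_mul_of_nonneg_right (abs_moebiusLogSum_sub_one_le
      ((one_le_div hn0').mpr ((Nat.le_floor_iff hR0.le).mp hn1))) (by positivity)
  have h6 : 0 ≤ ∑ n ∈ Ioc ⌊R / Y⌋₊ ⌊R⌋₊, (n : ℝ)⁻¹ := sum_nonneg fun _ _ => by positivity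
  nlinarith

end CoprimeMoebiusSum

section SelbergForm

open ArithmeticFunction Topology
open scoped ArithmeticFunction.Moebius ArithmeticFunction.zeta

/-- The integers in `[1, R]` coprime to `W`. -/
def coprimeSupport (W : ℕ) (R : ℝ) : Finset ℕ := (Ioc 0 ⌊R⌋₊).filter fun d => d.Coprime W

/-- The squarefree integers in `[1, R]` coprime to `W`. -/
def squarefreeSupport (W : ℕ) (R : ℝ) : Finset ℕ :=
  (Ioc 0 ⌊R⌋₊).filter fun d => Squarefree d ∧ d.Coprime W

/-- The weights `μ(d) log(R / d)`. -/
def selbergWeight (R : ℝ) (d : ℕ) : ℝ := (μ d : ℝ) * Real.log (R / d)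

/-- The quadratic form `∑_{d, e} λ_d λ_e / [d, e]`. -/
def selbergForm (W : ℕ) (R : ℝ) : ℝ :=
  ∑ d ∈ coprimeSupport W R, ∑ e ∈ coprimeSupport W R,
    selbergWeight R d * selbergWeight R e / (d.lcm e : ℝ)

/-- The diagonal coordinates of the quadratic form. -/
def selbergCoord (W : ℕ) (R : ℝ) (f : ℕ) : ℝ :=
  ∑ d ∈ coprimeSupport W R with f ∣ d, selbergWeight R d / d

/-- The sum of `1 / φ(f)` over the squarefree support. -/
def totientInvSum (W : ℕ) (R : ℝ) : ℝ := ∑ f ∈ squarefreeSupport W R, (f.totient : ℝ)⁻¹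

lemma inv_lcm_eq_sum_totient {n d e : ℕ} (hd : d ∈ Ioc 0 n) (he : e ∈ Ioc 0 n) :
    ((d.lcm e : ℕ) : ℝ)⁻¹ =
      ∑ f ∈ Ioc 0 n, if f ∣ d ∧ f ∣ e then (f.totient : ℝ) * (d : ℝ)⁻¹ * (e : ℝ)⁻¹ else 0 := by
  obtain ⟨hd0, hd1⟩ := mem_Ioc.mp hd
  have he0 := (mem_Ioc.mp he).1
  have h1 : (Ioc 0 n).filter (fun f => f ∣ d ∧ f ∣ e) = (d.gcd e).divisors := by
    ext f
    simp only [mem_filter, mem_Ioc, Nat.mem_divisors, Nat.dvd_gcd_iff]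
    constructor
    · rintro ⟨-, h⟩
      exact ⟨h, (Nat.gcd_pos_of_pos_left e hd0).ne'⟩
    · rintro ⟨h, -⟩
      exact ⟨⟨Nat.pos_of_dvd_of_pos h.1 hd0, (Nat.le_of_dvd hd0 h.1).trans hd1⟩, h⟩
  rw [← sum_filter, h1, ← sum_mul, ← sum_mul, ← Nat.cast_sum, Nat.sum_totient]
  have h2 : ((d.gcd e : ℕ) : ℝ) * (d.lcm e : ℕ) = d * e := by exact_mod_cast Nat.gcd_mul_lcm d e
  have hd0' : (d : ℝ) ≠ 0 := by exact_mod_cast hd0.ne'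
  have he0' : (e : ℝ) ≠ 0 := by exact_mod_cast he0.ne'
  have h3 : ((d.lcm e : ℕ) : ℝ) ≠ 0 := by exact_mod_cast (Nat.lcm_pos hd0 he0).ne'
  field_simp
  linarith

lemma selbergForm_eq_sum_sq (W : ℕ) (R : ℝ) :
    selbergForm W R = ∑ f ∈ Ioc 0 ⌊R⌋₊, (f.totient : ℝ) * selbergCoord W R f ^ 2 := by
  have h1 : ∀ f, (f.totient : ℝ) * selbergCoord W R f ^ 2 =
      ∑ d ∈ coprimeSupport W R, ∑ e ∈ coprimeSupport W R, selbergWeight R d * selbergWeight R e *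
        if f ∣ d ∧ f ∣ e then (f.totient : ℝ) * (d : ℝ)⁻¹ * (e : ℝ)⁻¹ else 0 := fun f => by
    rw [selbergCoord, sq, sum_filter, sum_mul_sum, mul_sum]
    refine sum_congr rfl fun d _ => ?_
    rw [mul_sum]
    refine sum_congr rfl fun e _ => ?_
    by_cases h1 : f ∣ d <;> by_cases h2 : f ∣ e <;> simp [h1, h2]
    ring
  simp only [h1]
  rw [sum_comm, selbergForm]
  refine sum_congr rfl fun d hd => ?_
  rw [sum_comm]
  refine sum_congr rfl fun e he => ?_
  rw [div_eq_mul_inv, inv_lcm_eq_sum_totient (mem_filter.mp hd).1 (mem_filter.mp he).1, mul_sum]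

lemma selbergCoord_eq_zero {W : ℕ} {R : ℝ} {f : ℕ} (hf : f ∈ Ioc 0 ⌊R⌋₊)
    (hf' : f ∉ squarefreeSupport W R) : selbergCoord W R f = 0 := by
  refine sum_eq_zero fun d hd => ?_
  obtain ⟨h1, h2⟩ := mem_filter.mp hd
  have h3 := (mem_filter.mp h1).2
  by_cases hs : Squarefree d
  · exact absurd (mem_filter.mpr ⟨hf, hs.squarefree_of_dvd h2, h3.coprime_dvd_left h2⟩) hf'
  · simp [selbergWeight, moebius_eq_zero_of_not_squarefree hs]

lemma sum_squarefreeSupport (W : ℕ) (R : ℝ) (g : ℕ → ℝ)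
    (hg : ∀ f, selbergCoord W R f = 0 → g f = 0) :
    ∑ f ∈ Ioc 0 ⌊R⌋₊, g f = ∑ f ∈ squarefreeSupport W R, g f :=
  (sum_subset (filter_subset _ _) fun f hf hf' => hg f (selbergCoord_eq_zero hf hf')).symm

lemma selbergCoord_eq {W : ℕ} {R : ℝ} {f : ℕ} (hf : f ∈ squarefreeSupport W R) :
    selbergCoord W R f = (μ f : ℝ) / f * coprimeMoebiusLogSum (f * W) (R / f) := by
  obtain ⟨hf1, hfs, hfW⟩ := mem_filter.mp hf
  have hf0 := (mem_Ioc.mp hf1).1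
  rw [selbergCoord, coprimeMoebiusLogSum, Nat.floor_div_natCast]
  trans ∑ m ∈ Ioc 0 (⌊R⌋₊ / f) with m.Coprime W, selbergWeight R (f * m) / (f * m : ℕ)
  · refine sum_nbij' (fun d => d / f) (fun m => f * m) ?_ ?_ ?_ ?_ ?_
    · intro d hd
      simp only [coprimeSupport, mem_filter, mem_Ioc] at hd ⊢
      obtain ⟨⟨⟨h1, h2⟩, h3⟩, h4⟩ := hd
      exact ⟨⟨Nat.div_pos (Nat.le_of_dvd h1 h4) hf0, Nat.div_le_div_right h2⟩,
        h3.coprime_dvd_left (Nat.div_dvd_of_dvd h4)⟩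
    · intro m hm
      simp only [coprimeSupport, mem_filter, mem_Ioc] at hm ⊢
      obtain ⟨⟨h1, h2⟩, h3⟩ := hm
      refine ⟨⟨⟨Nat.mul_pos hf0 h1, ?_⟩, Nat.Coprime.mul_left hfW h3⟩, Dvd.intro _ rfl⟩
      rw [mul_comm]
      exact (Nat.le_div_iff_mul_le hf0).mp h2
    · intro d hd
      exact Nat.mul_div_cancel' (mem_filter.mp hd).2
    · intro m _
      exact Nat.mul_div_cancel_left m hf0
    · intro d hd
      rw [Nat.mul_div_cancel' (mem_filter.mp hd).2]
  · rw [mul_sum]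
    refine (sum_subset_zero_on_sdiff ?_ ?_ ?_).symm
    · intro m hm
      obtain ⟨hm1, hm2⟩ := mem_filter.mp hm
      exact mem_filter.mpr ⟨hm1, (Nat.coprime_mul_iff_right.mp hm2).2⟩
    · intro m hm
      obtain ⟨hm1, hm2⟩ := Finset.mem_sdiff.mp hm
      obtain ⟨hm3, hm4⟩ := mem_filter.mp hm1
      have h1 : ¬ m.Coprime f := fun h =>
        hm2 (mem_filter.mpr ⟨hm3, Nat.coprime_mul_iff_right.mpr ⟨h, hm4⟩⟩)
      have h2 : ¬ Squarefree (f * m) := fun h => h1 (Nat.coprime_of_squarefree_mul h).symm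
      simp [selbergWeight, moebius_eq_zero_of_not_squarefree h2]
    · intro m hm
      have h1 := (Nat.coprime_mul_iff_right.mp (mem_filter.mp hm).2).1.symm
      rw [selbergWeight, isMultiplicative_moebius.map_mul_of_coprime h1]
      push_cast
      rw [div_div]
      field_simp

lemma sum_moebius_mul_selbergCoord {W : ℕ} {R : ℝ} (hR : 1 ≤ R) :
    ∑ f ∈ squarefreeSupport W R, (μ f : ℝ) * selbergCoord W R f = Real.log R := by
  rw [← sum_squarefreeSupport W R _ (fun f h => by rw [h, mul_zero])]
  have h1 : ∀ f, (μ f : ℝ) * selbergCoord W R f = ∑ d ∈ coprimeSupport W R,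
      if f ∣ d then (μ f : ℝ) * (selbergWeight R d / d) else 0 := fun f => by
    rw [selbergCoord, mul_sum, sum_filter]
  simp only [h1]
  rw [sum_comm]
  have h2 : ∀ d ∈ coprimeSupport W R, (∑ f ∈ Ioc 0 ⌊R⌋₊, if f ∣ d then
      (μ f : ℝ) * (selbergWeight R d / d) else 0) = if d = 1 then Real.log R else 0 := by
    intro d hd
    obtain ⟨hd0, hd1⟩ := mem_Ioc.mp (mem_filter.mp hd).1
    have h3 : (Ioc 0 ⌊R⌋₊).filter (fun f => f ∣ d) = d.divisors := by
      ext f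
      simp only [mem_filter, mem_Ioc, Nat.mem_divisors]
      constructor
      · rintro ⟨-, h⟩
        exact ⟨h, hd0.ne'⟩
      · rintro ⟨h, -⟩
        exact ⟨⟨Nat.pos_of_dvd_of_pos h hd0, (Nat.le_of_dvd hd0 h).trans hd1⟩, h⟩
    rw [← sum_filter, h3, ← sum_mul, ← Int.cast_sum, ← coe_mul_zeta_apply, moebius_mul_coe_zeta,
      one_apply]
    split_ifs with h
    · simp [h, selbergWeight]
    · simp
  rw [sum_congr rfl h2, sum_ite_eq' , if_pos]
  simp [coprimeSupport, hR]

/-- The lower bound for the quadratic form under the normalization of its first coefficient. -/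
lemma log_sq_le_totientInvSum_mul_selbergForm {W : ℕ} {R : ℝ} (hR : 1 ≤ R) :
    Real.log R ^ 2 ≤ totientInvSum W R * selbergForm W R := by
  rw [← sum_moebius_mul_selbergCoord (W := W) hR, selbergForm_eq_sum_sq,
    sum_squarefreeSupport W R _ (fun f h => by rw [h]; simp), totientInvSum]
  refine sum_sq_le_sum_mul_sum_of_sq_le_mul _ (fun f _ => by positivity)
    (fun f _ => by positivity) fun f hf => ?_
  obtain ⟨hf1, hfs, -⟩ := mem_filter.mp hf
  have h1 : ((μ f : ℤ) : ℝ) ^ 2 = 1 := by exact_mod_cast moebius_sq_eq_one_of_squarefree hfs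
  have h2 : (f.totient : ℝ) ≠ 0 := by
    exact_mod_cast (Nat.totient_pos.mpr (mem_Ioc.mp hf1).1).ne'
  rw [mul_pow, h1]
  refine le_of_eq ?_
  field_simp

lemma sum_inv_mul_moebiusLogError_le (W : ℕ) {R : ℝ} (hW : W ≠ 0) :
    ∑ f ∈ squarefreeSupport W R, (f : ℝ)⁻¹ *
      ∑ j ∈ primePowersOf (f * W) (R / f), (j : ℝ)⁻¹ * moebiusLogError (R / f / j) ≤
      ∑ n ∈ Ioc 0 ⌊R⌋₊, (n : ℝ)⁻¹ * moebiusLogError (R / n) := by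
  have h1 : ∀ f ∈ squarefreeSupport W R, (f : ℝ)⁻¹ *
      ∑ j ∈ primePowersOf (f * W) (R / f), (j : ℝ)⁻¹ * moebiusLogError (R / f / j) =
      ∑ j ∈ primePowersOf (f * W) (R / f),
        ((f * j : ℕ) : ℝ)⁻¹ * moebiusLogError (R / (f * j : ℕ)) := fun f _ => by
    rw [mul_sum]
    refine sum_congr rfl fun j _ => ?_
    push_cast
    rw [div_div, mul_inv, mul_assoc]
  rw [sum_congr rfl h1, sum_sigma']
  have hinj : Set.InjOn (fun x : (_ : ℕ) × ℕ => x.1 * x.2)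
      ((squarefreeSupport W R).sigma fun f => primePowersOf (f * W) (R / f) : Finset _) := by
    have key : ∀ x ∈ (squarefreeSupport W R).sigma fun f => primePowersOf (f * W) (R / f),
        x.1 ≠ 0 ∧ ∏ p ∈ (x.1 * x.2).primeFactors with ¬ p ∣ W, p = x.1 := by
      rintro ⟨f, j⟩ hx
      obtain ⟨hf, hj⟩ := mem_sigma.mp hx
      obtain ⟨hf1, hfs, hfW⟩ := mem_filter.mp hf
      obtain ⟨hj1, hj2⟩ := mem_filter.mp hj
      have hf0 := (mem_Ioc.mp hf1).1.ne'
      have hj0 := (mem_Ioc.mp hj1).1.ne'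
      refine ⟨hf0, ?_⟩
      dsimp only at hj2 ⊢
      convert! Nat.prod_primeFactors_of_squarefree hfs using 2
      rw [Nat.primeFactors_mul hf0 hW] at hj2
      ext p
      rw [mem_filter, Nat.primeFactors_mul hf0 hj0, mem_union]
      constructor
      · rintro ⟨h | h, hpW⟩
        · exact h
        · rcases mem_union.mp (hj2 h) with h | h
          · exact h
          · exact absurd (Nat.dvd_of_mem_primeFactors h) hpW
      · intro h
        refine ⟨Or.inl h, fun hpW => ?_⟩
        exact (Nat.prime_of_mem_primeFactors h).one_lt.ne'
          (Nat.eq_one_of_dvd_coprimes hfW (Nat.dvd_of_mem_primeFactors h) hpW)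
    rintro ⟨f, j⟩ hx ⟨f', j'⟩ hx' h
    obtain ⟨hf, e1⟩ := key _ (mem_coe.mp hx)
    obtain ⟨-, e2⟩ := key _ (mem_coe.mp hx')
    dsimp only at h hf e1 e2
    have hff : f = f' := by rw [← e1, ← e2, h]
    subst hff
    rw [Nat.eq_of_mul_eq_mul_left (Nat.pos_of_ne_zero hf) h]
  rw [← sum_image (f := fun n : ℕ => (n : ℝ)⁻¹ * moebiusLogError (R / n)) hinj]
  refine sum_le_sum_of_subset_of_nonneg ?_ fun n _ _ => mul_nonneg (by positivity) (abs_nonneg _)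
  intro n hn
  obtain ⟨⟨f, j⟩, hx, rfl⟩ := mem_image.mp hn
  obtain ⟨hf, hj⟩ := mem_sigma.mp hx
  obtain ⟨hf0, -⟩ := mem_Ioc.mp (mem_filter.mp hf).1
  obtain ⟨hj0, hj1⟩ := mem_Ioc.mp (mem_filter.mp hj).1
  dsimp only at hf0 hj0 hj1 ⊢
  rw [Nat.floor_div_natCast] at hj1
  rw [mem_Ioc]
  refine ⟨Nat.mul_pos hf0 hj0, ?_⟩
  rw [mul_comm]
  exact (Nat.le_div_iff_mul_le hf0).mp hj1

/-- The upper bound for the quadratic form. -/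
lemma selbergForm_le {W : ℕ} {R : ℝ} (hW : W ≠ 0) (hR : 1 ≤ R) :
    selbergForm W R ≤ ((W : ℝ) / W.totient) ^ 2 * totientInvSum W R +
      6 * ((W : ℝ) / W.totient) * ∑ n ∈ Ioc 0 ⌊R⌋₊, (n : ℝ)⁻¹ * moebiusLogError (R / n) := by
  set ρ := (W : ℝ) / W.totient with hρ
  have hρ0 : 0 ≤ ρ := by positivity
  rw [selbergForm_eq_sum_sq, sum_squarefreeSupport W R _ (fun f h => by rw [h]; simp)]
  refine le_trans ?_ (add_le_add_right (mul_le_mul_of_nonneg_left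
    (sum_inv_mul_moebiusLogError_le W (R := R) hW) (by positivity : 0 ≤ 6 * ρ)) _)
  rw [totientInvSum, mul_sum, mul_sum, ← sum_add_distrib]
  refine sum_le_sum fun f hf => ?_
  obtain ⟨hf1, hfs, hfW⟩ := mem_filter.mp hf
  have hf0 := (mem_Ioc.mp hf1).1
  have hf0' : (0 : ℝ) < f := by exact_mod_cast hf0
  have hφ : (0 : ℝ) < f.totient := by exact_mod_cast Nat.totient_pos.mpr hf0
  have h1 : ((μ f : ℤ) : ℝ) ^ 2 = 1 := by exact_mod_cast moebius_sq_eq_one_of_squarefree hfs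
  have h2 := sq_coprimeMoebiusLogSum_le (mul_ne_zero hf0.ne' hW) (x := R / f) (by positivity)
  rw [Nat.totient_mul hfW] at h2
  push_cast at h2
  rw [mul_div_mul_comm, ← hρ] at h2
  rw [selbergCoord_eq hf, mul_pow, div_pow, h1]
  refine (mul_le_mul_of_nonneg_left (mul_le_mul_of_nonneg_left h2 (by positivity))
    (by positivity)).trans_eq ?_
  field_simp

end SelbergForm

section SelbergAsymptotic

open ArithmeticFunction Topology
open scoped ArithmeticFunction.Moebius ArithmeticFunction.zeta

lemma sum_Ioc_inv_eq_harmonic (n : ℕ) : ∑ i ∈ Ioc 0 n, (i : ℝ)⁻¹ = (harmonic n : ℝ) := by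
  rw [harmonic_eq_sum_Icc]; push_cast; rfl

lemma sum_range_coprime_inv_le {W : ℕ} (hW : 0 < W) (J : ℕ) :
    ∑ n ∈ range (W * (J + 1)) with W.Coprime n, (n : ℝ)⁻¹ ≤
      1 + Real.log W + (W.totient : ℝ) / W * ∑ i ∈ Ioc 0 J, (i : ℝ)⁻¹ := by
  have hW' : (0 : ℝ) < W := by exact_mod_cast hW
  induction J with
  | zero =>
    simp only [zero_add, mul_one, Ioc_self, sum_empty, mul_zero, add_zero]
    refine le_trans ?_ (harmonic_le_one_add_log W)
    rw [← sum_Ioc_inv_eq_harmonic]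
    have h : ∑ n ∈ range W with W.Coprime n, (n : ℝ)⁻¹ ≤ ∑ n ∈ range (W + 1), (n : ℝ)⁻¹ :=
      sum_le_sum_of_subset_of_nonneg (fun n hn => by
        have := mem_range.mp (mem_filter.mp hn).1
        exact mem_range.mpr (by omega)) fun _ _ _ => by positivity
    refine h.trans_eq ?_
    rw [sum_range_succ', Nat.cast_zero, inv_zero, add_zero, range_eq_Ico,
      sum_Ico_add' (fun n : ℕ => (n : ℝ)⁻¹)]
    rfl
  | succ J ih =>
    have h1 : W * (J + 1) ≤ W * (J + 1 + 1) := Nat.mul_le_mul_left _ (by omega)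
    have h2 : range (W * (J + 1 + 1)) =
        range (W * (J + 1)) ∪ Ico (W * (J + 1)) (W * (J + 1) + W) := by
      rw [range_eq_Ico, range_eq_Ico, Ico_union_Ico_eq_Ico (Nat.zero_le _) (Nat.le_add_right _ _)]
      rfl
    have h3 : ∑ n ∈ Ico (W * (J + 1)) (W * (J + 1) + W) with W.Coprime n, (n : ℝ)⁻¹ ≤
        (W.totient : ℝ) / W * ((J + 1 : ℕ) : ℝ)⁻¹ := by
      rw [div_mul_eq_mul_div, mul_div_assoc, ← Nat.filter_coprime_Ico_eq_totient W (W * (J + 1)),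
        ← nsmul_eq_mul]
      refine sum_le_card_nsmul _ _ _ fun n hn => ?_
      have h4 : W * (J + 1) ≤ n := (mem_Ico.mp (mem_filter.mp hn).1).1
      have h5 : (W : ℝ) * ((J + 1 : ℕ) : ℝ) ≤ n := by exact_mod_cast h4
      rw [div_eq_mul_inv, ← mul_inv, mul_comm]
      have h6 : (0 : ℝ) < ((J + 1 : ℕ) : ℝ) := by positivity
      exact inv_anti₀ (by positivity) h5
    rw [h2, filter_union, sum_union, ← Finset.insert_Ioc_right_eq_Ioc_add_one (Nat.zero_le J),
      sum_insert (by simp)]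
    · rw [mul_add ((W.totient : ℝ) / W)]
      linarith
    · refine disjoint_filter_filter (disjoint_left.mpr fun n hn hn' => ?_)
      have := mem_range.mp hn
      have := (mem_Ico.mp hn').1
      omega

lemma sum_coprime_inv_le {W : ℕ} (hW : 0 < W) {R : ℝ} (hR : 1 ≤ R) :
    ∑ n ∈ Ioc 0 ⌊R⌋₊ with n.Coprime W, (n : ℝ)⁻¹ ≤
      2 + Real.log W + (W.totient : ℝ) / W * Real.log R := by
  have hW' : (0 : ℝ) < W := by exact_mod_cast hW
  have hφ : (W.totient : ℝ) / W ≤ 1 := by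
    rw [div_le_one hW']; exact_mod_cast Nat.totient_le W
  have hφ0 : 0 ≤ (W.totient : ℝ) / W := by positivity
  have h1 : ∑ i ∈ Ioc 0 (⌊R⌋₊ / W), (i : ℝ)⁻¹ ≤ 1 + Real.log R := by
    refine le_trans ?_ (harmonic_floor_le_one_add_log R hR)
    rw [← sum_Ioc_inv_eq_harmonic]
    exact sum_le_sum_of_subset_of_nonneg (Ioc_subset_Ioc_right (Nat.div_le_self _ _))
      fun _ _ _ => by positivity
  have h2 : ∑ n ∈ Ioc 0 ⌊R⌋₊ with n.Coprime W, (n : ℝ)⁻¹ ≤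
      ∑ n ∈ range (W * (⌊R⌋₊ / W + 1)) with W.Coprime n, (n : ℝ)⁻¹ := by
    refine sum_le_sum_of_subset_of_nonneg (fun n hn => ?_) fun _ _ _ => by positivity
    obtain ⟨h3, h4⟩ := mem_filter.mp hn
    refine mem_filter.mpr ⟨mem_range.mpr ?_, h4.symm⟩
    exact (mem_Ioc.mp h3).2.trans_lt (Nat.lt_mul_div_succ _ hW)
  have h5 := h2.trans (sum_range_coprime_inv_le hW _)
  nlinarith

lemma sum_Ioc_inv_mul_pred_le {w : ℕ} (hw : 0 < w) (N : ℕ) :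
    ∑ n ∈ Ioc w N, ((n : ℝ) * (n - 1))⁻¹ ≤ (w : ℝ)⁻¹ := by
  rcases le_total N w with h | h
  · rw [Ioc_eq_empty (by omega), sum_empty]; positivity
  suffices ∑ n ∈ Ioc w N, ((n : ℝ) * (n - 1))⁻¹ = (w : ℝ)⁻¹ - (N : ℝ)⁻¹ by
    rw [this]
    have : (0 : ℝ) ≤ (N : ℝ)⁻¹ := by positivity
    linarith
  induction N, h using Nat.le_induction with
  | base => simp
  | succ N hN ih =>
    rw [← Finset.insert_Ioc_right_eq_Ioc_add_one hN, sum_insert (by simp), ih]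
    have : (0 : ℝ) < N := by exact_mod_cast hw.trans_le hN
    push_cast
    rw [add_sub_cancel_right]
    field_simp
    ring

lemma totient_eq_prod_of_squarefree {n : ℕ} (hn : Squarefree n) :
    (n.totient : ℝ) = ∏ p ∈ n.primeFactors, ((p : ℝ) - 1) := by
  have h := Nat.totient_mul_prod_primeFactors n
  rw [Nat.prod_primeFactors_of_squarefree hn, mul_comm] at h
  rw [Nat.eq_of_mul_eq_mul_left (Nat.pos_of_ne_zero hn.ne_zero) h, Nat.cast_prod]
  exact prod_congr rfl fun p hp => by
    rw [Nat.cast_sub (Nat.prime_of_mem_primeFactors hp).one_le, Nat.cast_one]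

lemma sum_squarefreeSupport_inv_mul_totient_le {W w : ℕ} (hw : 0 < w)
    (hWw : ∀ p, p.Prime → ¬ p ∣ W → w < p) (R : ℝ) :
    ∑ d ∈ squarefreeSupport W R, ((d : ℝ) * d.totient)⁻¹ ≤ Real.exp (w : ℝ)⁻¹ := by
  let g : ℕ → ℝ := fun p => ((p : ℝ) * (p - 1))⁻¹
  have hg : ∀ p, 0 ≤ g p := fun p => by
    rcases Nat.eq_zero_or_pos p with rfl | hp
    · simp [g]
    · have : (1 : ℝ) ≤ p := by exact_mod_cast hp
      exact inv_nonneg.mpr (mul_nonneg (by linarith) (by linarith))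
  have h1 : ∀ d ∈ squarefreeSupport W R, ((d : ℝ) * d.totient)⁻¹ = ∏ p ∈ d.primeFactors, g p := by
    intro d hd
    have hs := (mem_filter.mp hd).2.1
    conv_lhs => rw [totient_eq_prod_of_squarefree hs]
    nth_rw 1 [← Nat.prod_primeFactors_of_squarefree hs]
    rw [Nat.cast_prod, ← prod_mul_distrib, prod_inv_distrib]
  have hinj : Set.InjOn Nat.primeFactors (squarefreeSupport W R : Set ℕ) := fun d hd e he h => by
    rw [← Nat.prod_primeFactors_of_squarefree (mem_filter.mp (mem_coe.mp hd)).2.1, h,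
      Nat.prod_primeFactors_of_squarefree (mem_filter.mp (mem_coe.mp he)).2.1]
  rw [sum_congr rfl h1, ← sum_image (f := fun s : Finset ℕ => ∏ p ∈ s, g p) hinj]
  calc _ ≤ ∑ s ∈ (Ioc w ⌊R⌋₊).powerset, ∏ p ∈ s, g p := by
        refine sum_le_sum_of_subset_of_nonneg (fun s hs => ?_)
          fun s _ _ => prod_nonneg fun p _ => hg p
        obtain ⟨d, hd, rfl⟩ := mem_image.mp hs
        obtain ⟨h2, -, h3⟩ := mem_filter.mp hd
        obtain ⟨h4, h5⟩ := mem_Ioc.mp h2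
        refine mem_powerset.mpr fun p hp => mem_Ioc.mpr ⟨?_, ?_⟩
        · have hpp := Nat.prime_of_mem_primeFactors hp
          exact hWw p hpp fun hpW => hpp.one_lt.ne'
            (Nat.eq_one_of_dvd_coprimes h3 (Nat.dvd_of_mem_primeFactors hp) hpW)
        · exact (Nat.le_of_mem_primeFactors hp).trans h5
    _ = ∏ p ∈ Ioc w ⌊R⌋₊, (1 + g p) := (prod_one_add _).symm
    _ ≤ ∏ p ∈ Ioc w ⌊R⌋₊, Real.exp (g p) := prod_le_prod (fun p _ => by linarith [hg p])
        fun p _ => by linarith [Real.add_one_le_exp (g p)]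
    _ = Real.exp (∑ p ∈ Ioc w ⌊R⌋₊, g p) := (Real.exp_sum _ _).symm
    _ ≤ _ := Real.exp_le_exp.mpr (sum_Ioc_inv_mul_pred_le hw _)

lemma inv_totient_eq_of_squarefree {n : ℕ} (hn : Squarefree n) :
    (n.totient : ℝ)⁻¹ = (n : ℝ)⁻¹ * ∑ d ∈ n.divisors, (d.totient : ℝ)⁻¹ := by
  let g : ArithmeticFunction ℝ := ⟨fun d => (d.totient : ℝ)⁻¹, by simp⟩
  have hg : g.IsMultiplicative := by
    refine IsMultiplicative.iff_ne_zero.mpr ⟨by simp [g], fun {m n} _ _ hmn => ?_⟩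
    simp only [g, coe_mk, Nat.totient_mul hmn]
    push_cast
    rw [mul_inv]
  have h := hg.prodPrimeFactors_one_add_of_squarefree hn
  change _ = ∑ d ∈ n.divisors, (d.totient : ℝ)⁻¹ at h
  have hn0 : (n : ℝ) ≠ 0 := by exact_mod_cast hn.ne_zero
  rw [← h, eq_inv_mul_iff_mul_eq₀ hn0, totient_eq_prod_of_squarefree hn, ← prod_inv_distrib]
  nth_rw 1 [← Nat.prod_primeFactors_of_squarefree hn]
  rw [Nat.cast_prod, ← prod_mul_distrib]
  refine prod_congr rfl fun p hp => ?_
  have hpp := Nat.prime_of_mem_primeFactors hp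
  have : (1 : ℝ) < p := by exact_mod_cast hpp.one_lt
  have : (p : ℝ) - 1 ≠ 0 := by linarith
  simp only [g, coe_mk, Nat.totient_prime hpp]
  rw [Nat.cast_sub hpp.one_le, Nat.cast_one]
  field_simp
  ring

lemma totientInvSum_le {W w : ℕ} (hW : 0 < W) (hw : 0 < w)
    (hWw : ∀ p, p.Prime → ¬ p ∣ W → w < p) {R : ℝ} (hR : 1 ≤ R) :
    totientInvSum W R ≤ Real.exp (w : ℝ)⁻¹ *
      (2 + Real.log W + (W.totient : ℝ) / W * Real.log R) := by
  set K := ∑ n ∈ Ioc 0 ⌊R⌋₊ with n.Coprime W, (n : ℝ)⁻¹ with hK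
  have hK0 : 0 ≤ K := sum_nonneg fun _ _ => by positivity
  refine le_trans ?_ (mul_le_mul (sum_squarefreeSupport_inv_mul_totient_le hw hWw R)
    (sum_coprime_inv_le hW hR) hK0 (Real.exp_pos _).le)
  rw [← hK, sum_mul, totientInvSum]
  have h1 : ∀ f ∈ squarefreeSupport W R, (f.totient : ℝ)⁻¹ =
      ∑ d ∈ squarefreeSupport W R, if d ∣ f then (f : ℝ)⁻¹ * (d.totient : ℝ)⁻¹ else 0 := by
    intro f hf
    obtain ⟨h2, h3, h4⟩ := mem_filter.mp hf
    obtain ⟨h5, h6⟩ := mem_Ioc.mp h2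
    rw [inv_totient_eq_of_squarefree h3, ← sum_filter, mul_sum]
    refine sum_congr ?_ fun _ _ => rfl
    ext d
    rw [mem_filter, Nat.mem_divisors]
    constructor
    · rintro ⟨h, -⟩
      exact ⟨mem_filter.mpr ⟨mem_Ioc.mpr ⟨Nat.pos_of_dvd_of_pos h h5, (Nat.le_of_dvd h5 h).trans h6⟩,
        h3.squarefree_of_dvd h, h4.coprime_dvd_left h⟩, h⟩
    · rintro ⟨-, h⟩
      exact ⟨h, h5.ne'⟩
  rw [sum_congr rfl h1, sum_comm]
  refine sum_le_sum fun d hd => ?_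
  have hd0 : 0 < d := (mem_Ioc.mp (mem_filter.mp hd).1).1
  rw [← sum_filter, ← sum_mul, mul_inv, mul_assoc, mul_comm (d.totient : ℝ)⁻¹, ← mul_assoc]
  refine mul_le_mul_of_nonneg_right ?_ (by positivity)
  rw [hK, mul_sum]
  have hinj : Set.InjOn (fun f => f / d)
      ((squarefreeSupport W R).filter (fun f => d ∣ f) : Set ℕ) := fun a ha b hb h => by
    have h1 := Nat.div_mul_cancel (mem_filter.mp (mem_coe.mp ha)).2
    have h2 := Nat.div_mul_cancel (mem_filter.mp (mem_coe.mp hb)).2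
    dsimp only at h
    rw [← h1, ← h2, h]
  have h7 : ∀ f ∈ (squarefreeSupport W R).filter (fun f => d ∣ f),
      (f : ℝ)⁻¹ = (d : ℝ)⁻¹ * ((f / d : ℕ) : ℝ)⁻¹ := fun f hf => by
    rw [← mul_inv, ← Nat.cast_mul, Nat.mul_div_cancel' (mem_filter.mp hf).2]
  rw [sum_congr rfl h7, ← sum_image (f := fun n : ℕ => (d : ℝ)⁻¹ * (n : ℝ)⁻¹) hinj]
  refine sum_le_sum_of_subset_of_nonneg (fun n hn => ?_) fun _ _ _ => by positivity
  obtain ⟨f, hf, rfl⟩ := mem_image.mp hn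
  obtain ⟨hf1, hf2⟩ := mem_filter.mp hf
  obtain ⟨h2, h3, h4⟩ := mem_filter.mp hf1
  obtain ⟨h5, h6⟩ := mem_Ioc.mp h2
  exact mem_filter.mpr ⟨mem_Ioc.mpr ⟨Nat.div_pos (Nat.le_of_dvd h5 hf2) hd0,
    (Nat.div_le_self _ _).trans h6⟩, h4.coprime_dvd_left (Nat.div_dvd_of_dvd hf2)⟩

/-- The asymptotic evaluation of the quadratic form, uniformly in the presieving modulus. -/
theorem abs_selbergForm_div_log_sub_one_le {η : ℝ} (hη : 0 < η) (hη1 : η ≤ 1) :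
    ∃ w₀ : ℕ, ∃ τ > 0, ∃ R₀ : ℝ, ∀ (W w : ℕ) (R : ℝ), 0 < W → w₀ ≤ w →
      (∀ p, p.Prime → ¬ p ∣ W → w < p) → R₀ ≤ R → W * (2 + Real.log W) ≤ τ * Real.log R →
      |(W.totient : ℝ) / W * selbergForm W R / Real.log R - 1| ≤ η := by
  obtain ⟨C, hC0, hC⟩ := sum_moebiusLogError_le (show 0 < η / 24 by positivity)
  have hexp : ∀ᶠ w : ℕ in atTop, Real.exp (w : ℝ)⁻¹ < 1 + η / 8 := by
    have h : Tendsto (fun w : ℕ => Real.exp (w : ℝ)⁻¹) atTop (𝓝 (Real.exp 0)) :=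
      (Real.continuous_exp.tendsto 0).comp tendsto_inv_atTop_nhds_zero_nat
    rw [Real.exp_zero] at h
    exact h.eventually_lt_const (by linarith)
  obtain ⟨w₁, hw₁⟩ := eventually_atTop.mp hexp
  refine ⟨max w₁ 1, η / 8, by positivity, Real.exp (max 1 (24 * C / η)), ?_⟩
  intro W w R hW hw hWw hR hWR
  have hw0 : 0 < w := (le_max_right _ _).trans hw
  have hE := hw₁ w ((le_max_left _ _).trans hw)
  set E := Real.exp (w : ℝ)⁻¹
  have hE0 : 0 < E := Real.exp_pos _
  have hR0 : 0 < R := (Real.exp_pos _).trans_le hR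
  have hL := (Real.le_log_iff_exp_le hR0).mpr hR
  have hR1 : 1 ≤ R := (Real.one_le_exp (le_max_of_le_left zero_le_one)).trans hR
  set L := Real.log R
  have hL1 : 1 ≤ L := (le_max_left _ _).trans hL
  have hLC : C ≤ η / 24 * L := by
    have h := (le_max_right _ _).trans hL
    rw [div_le_iff₀ hη] at h
    linarith
  have hW' : (1 : ℝ) ≤ W := by exact_mod_cast hW
  have hφ1 : (1 : ℝ) ≤ W.totient := by exact_mod_cast Nat.totient_pos.mpr hW
  set ρ := (W : ℝ) / W.totient with hρ
  have hρ0 : 0 < ρ := by positivity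
  have hρW : ρ ≤ W := div_le_self (by linarith) hφ1
  have hinv : (W.totient : ℝ) / W = ρ⁻¹ := by rw [hρ, inv_div]
  have hlogW := Real.log_nonneg hW'
  have hV := totientInvSum_le hW hw0 hWw hR1
  have hup := selbergForm_le hW.ne' hR1
  have hlow := log_sq_le_totientInvSum_mul_selbergForm (W := W) hR1
  have hH := hC R hR1
  rw [← hρ] at hup
  rw [hinv] at hV ⊢
  set V := totientInvSum W R
  set S := selbergForm W R
  set H := ∑ n ∈ Ioc 0 ⌊R⌋₊, (n : ℝ)⁻¹ * moebiusLogError (R / n)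
  have hu : ρ * V ≤ (1 + η / 2) * L := by
    calc ρ * V ≤ ρ * (E * (2 + Real.log W + ρ⁻¹ * L)) := by gcongr
      _ = E * (ρ * (2 + Real.log W) + L) := by field_simp
      _ ≤ (1 + η / 8) * (η / 8 * L + L) := by
          have := (mul_le_mul_of_nonneg_right hρW (by linarith : 0 ≤ 2 + Real.log W)).trans hWR
          exact mul_le_mul hE.le (by linarith) (by positivity) (by linarith)
      _ ≤ (1 + η / 2) * L := by nlinarith
  have hx : ρ⁻¹ * S ≤ (1 + η) * L := by
    calc ρ⁻¹ * S ≤ ρ⁻¹ * (ρ ^ 2 * V + 6 * ρ * H) := by gcongr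
      _ = ρ * V + 6 * H := by field_simp
      _ ≤ (1 + η) * L := by linarith
  have hy : (1 - η) * L ≤ ρ⁻¹ * S := by
    have hS0 : 0 ≤ ρ⁻¹ * S := by
      refine mul_nonneg (by positivity) ?_
      change 0 ≤ selbergForm W R
      rw [selbergForm_eq_sum_sq]
      exact sum_nonneg fun _ _ => by positivity
    have h1 : L ^ 2 ≤ (ρ * V) * (ρ⁻¹ * S) := by
      refine hlow.trans_eq ?_
      field_simp
    have h2 := h1.trans (mul_le_mul_of_nonneg_right hu hS0)
    have h3 : L ≤ (1 + η / 2) * (ρ⁻¹ * S) := by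
      refine le_of_mul_le_mul_left ?_ (by linarith : 0 < L)
      linarith
    nlinarith
  rw [abs_le]
  constructor
  · rw [le_sub_iff_add_le, le_div_iff₀ (by linarith)]
    linarith
  · rw [sub_le_iff_le_add, div_le_iff₀ (by linarith)]
    linarith

end SelbergAsymptotic

section SieveAverage

open ArithmeticFunction Topology
open scoped ArithmeticFunction.Moebius ArithmeticFunction.zeta

lemma abs_card_Ico_modEq_sub_le (A B v : ℕ) {l : ℕ} (hl : 0 < l) :
    |(((Ico A B).filter fun x => x ≡ v [MOD l]).card : ℝ) - ((B - A : ℕ) : ℝ) / l| ≤ 1 := by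
  have hl' : (0 : ℚ) < l := by exact_mod_cast hl
  rcases le_total B A with h | h
  · rw [Ico_eq_empty (by omega), Nat.sub_eq_zero_of_le h]
    simp
  suffices hq : |(((Ico A B).filter fun x => x ≡ v [MOD l]).card : ℚ) -
      ((B - A : ℕ) : ℚ) / l| ≤ 1 by
    have hr := (Rat.cast_le (K := ℝ)).mpr hq
    rwa [Rat.cast_abs, Rat.cast_sub, Rat.cast_div, Rat.cast_natCast, Rat.cast_natCast,
      Rat.cast_natCast, Rat.cast_one] at hr
  have h1 := Nat.Ico_filter_modEq_card A B hl v
  have h2 : ((A : ℚ) - v) / l ≤ ((B : ℚ) - v) / l := by gcongr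
  rw [max_eq_left (sub_nonneg.mpr (Int.ceil_mono h2))] at h1
  have h3 : (((Ico A B).filter fun x => x ≡ v [MOD l]).card : ℚ) =
      (⌈((B : ℚ) - v) / l⌉ : ℚ) - (⌈((A : ℚ) - v) / l⌉ : ℚ) := by exact_mod_cast h1
  have h4 : ((B - A : ℕ) : ℚ) / l = ((B : ℚ) - v) / l - ((A : ℚ) - v) / l := by
    rw [Nat.cast_sub h]; ring
  rw [h3, h4, abs_le]
  have := Int.le_ceil (((B : ℚ) - v) / l)
  have := Int.ceil_lt_add_one (((B : ℚ) - v) / l)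
  have := Int.le_ceil (((A : ℚ) - v) / l)
  have := Int.ceil_lt_add_one (((A : ℚ) - v) / l)
  constructor <;> linarith

lemma abs_card_dvd_linear_sub_le (A B N : ℕ) {W l : ℕ} (hl : 0 < l) (hlW : l.Coprime W) :
    |(((Ico A B).filter fun v => l ∣ W * (N + v) + 1).card : ℝ) - ((B - A : ℕ) : ℝ) / l| ≤ 1 := by
  have : NeZero l := ⟨hl.ne'⟩
  let u := ZMod.unitOfCoprime W hlW.symm
  have hu : ((u : (ZMod l)ˣ) : ZMod l) = (W : ZMod l) := ZMod.coe_unitOfCoprime W hlW.symm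
  have h : ∀ v : ℕ, l ∣ W * (N + v) + 1 ↔
      v ≡ (-((u⁻¹ : (ZMod l)ˣ) : ZMod l) - N).val [MOD l] := fun v => by
    rw [← ZMod.natCast_eq_zero_iff, ← ZMod.natCast_eq_natCast_iff, ZMod.natCast_zmod_val]
    push_cast
    rw [← hu]
    constructor
    · intro h
      have h' := congrArg (fun z => ((u⁻¹ : (ZMod l)ˣ) : ZMod l) * z) h
      simp only [mul_add, ← mul_assoc, Units.inv_mul, one_mul, mul_one, mul_zero] at h'
      linear_combination h'
    · intro h
      rw [h]
      have := Units.mul_inv u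
      linear_combination -this
  simp only [h]
  exact abs_card_Ico_modEq_sub_le A B _ hl

lemma LambdaR_eq_sum (W m : ℕ) {R : ℝ} (hR : 0 ≤ R) :
    LambdaR R (W * m + 1) =
      ∑ d ∈ coprimeSupport W R, if d ∣ W * m + 1 then selbergWeight R d else 0 := by
  rw [LambdaR, ← sum_filter]
  refine sum_congr ?_ fun _ _ => rfl
  ext d
  simp only [coprimeSupport, mem_filter, Nat.mem_divisors, mem_Ioc, Nat.le_floor_iff hR]
  constructor
  · rintro ⟨⟨h1, -⟩, h2⟩
    refine ⟨⟨⟨Nat.pos_of_dvd_of_pos h1 (Nat.succ_pos _), h2⟩, ?_⟩, h1⟩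
    refine Nat.Coprime.coprime_dvd_left h1 ?_
    simp
  · rintro ⟨⟨⟨-, h2⟩, -⟩, h1⟩
    exact ⟨⟨h1, Nat.succ_ne_zero _⟩, h2⟩

lemma abs_selbergWeight_le {R : ℝ} (hR : 1 ≤ R) {W d : ℕ} (hd : d ∈ coprimeSupport W R) :
    |selbergWeight R d| ≤ Real.log R := by
  obtain ⟨h1, h2⟩ := mem_Ioc.mp (mem_filter.mp hd).1
  have h_one : (1 : ℝ) ≤ d := by exact_mod_cast h1
  have h3 := (Nat.le_floor_iff (by linarith)).mp h2
  have h4 : 0 ≤ Real.log (R / d) := Real.log_nonneg ((one_le_div (by linarith)).mpr h3)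
  rw [selbergWeight, abs_mul, abs_of_nonneg h4]
  calc _ ≤ 1 * Real.log (R / d) := mul_le_mul_of_nonneg_right (abs_moebius_real_le_one d) h4
    _ ≤ Real.log R := by
      rw [one_mul]
      exact Real.log_le_log (by positivity) (div_le_self (by linarith) h_one)

/-- The second moment of the truncated divisor sum on an interval in a progression. -/
lemma abs_sum_LambdaR_sq_sub_le (A B N W : ℕ) {R : ℝ} (hR : 1 ≤ R) :
    |∑ v ∈ Ico A B, LambdaR R (W * (N + v) + 1) ^ 2 - ((B - A : ℕ) : ℝ) * selbergForm W R| ≤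
      (R * Real.log R) ^ 2 := by
  have hR0 : 0 ≤ R := by linarith
  have hL := Real.log_nonneg hR
  have h1 : ∑ v ∈ Ico A B, LambdaR R (W * (N + v) + 1) ^ 2 =
      ∑ d ∈ coprimeSupport W R, ∑ e ∈ coprimeSupport W R, selbergWeight R d * selbergWeight R e *
        (((Ico A B).filter fun v => d.lcm e ∣ W * (N + v) + 1).card : ℝ) := by
    have h2 : ∀ v, LambdaR R (W * (N + v) + 1) ^ 2 = ∑ d ∈ coprimeSupport W R,
        ∑ e ∈ coprimeSupport W R, selbergWeight R d * selbergWeight R e *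
          if d.lcm e ∣ W * (N + v) + 1 then 1 else 0 := fun v => by
      rw [LambdaR_eq_sum _ _ hR0, sq, sum_mul_sum]
      refine sum_congr rfl fun d _ => sum_congr rfl fun e _ => ?_
      by_cases h3 : d ∣ W * (N + v) + 1 <;> by_cases h4 : e ∣ W * (N + v) + 1 <;>
        simp [h3, h4, Nat.lcm_dvd_iff]
    simp only [h2]
    rw [sum_comm]
    refine sum_congr rfl fun d _ => ?_
    rw [sum_comm]
    refine sum_congr rfl fun e _ => ?_
    rw [← mul_sum, sum_boole]
  have hcard : ((coprimeSupport W R).card : ℝ) ≤ R := by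
    refine le_trans ?_ (Nat.floor_le hR0)
    exact_mod_cast (card_filter_le _ _).trans (by simp)
  rw [h1, selbergForm, mul_sum, ← sum_sub_distrib]
  calc _ ≤ ∑ d ∈ coprimeSupport W R, ∑ e ∈ coprimeSupport W R, Real.log R * Real.log R := by
        refine (abs_sum_le_sum_abs _ _).trans (sum_le_sum fun d hd => ?_)
        rw [mul_sum, ← sum_sub_distrib]
        refine (abs_sum_le_sum_abs _ _).trans (sum_le_sum fun e he => ?_)
        have hd0 := (mem_Ioc.mp (mem_filter.mp hd).1).1
        have he0 := (mem_Ioc.mp (mem_filter.mp he).1).1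
        have hcop : (d.lcm e).Coprime W := Nat.Coprime.coprime_dvd_left (Nat.lcm_dvd_mul d e)
          (Nat.Coprime.mul_left (mem_filter.mp hd).2 (mem_filter.mp he).2)
        have h5 := abs_card_dvd_linear_sub_le A B N (Nat.lcm_pos hd0 he0) hcop
        have h6 := mul_le_mul (mul_le_mul (abs_selbergWeight_le hR hd) (abs_selbergWeight_le hR he)
          (abs_nonneg _) hL) h5 (abs_nonneg _) (by positivity)
        rw [← abs_mul, ← abs_mul, mul_one] at h6
        refine le_trans (le_of_eq ?_) h6
        congr 1
        ring
    _ = (((coprimeSupport W R).card : ℝ) * Real.log R) ^ 2 := by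
        simp only [sum_const, nsmul_eq_mul]
        ring
    _ ≤ _ := by gcongr

lemma sum_range_eq_sum_zmod {m : ℕ} [NeZero m] (g : ZMod m → ℝ) :
    ∑ x ∈ range m, g (x : ZMod m) = ∑ z : ZMod m, g z := by
  refine sum_nbij' (fun x => (x : ZMod m)) ZMod.val (fun _ _ => mem_univ _)
    (fun z _ => mem_range.mpr z.val_lt) (fun x hx => ZMod.val_cast_of_lt (mem_range.mp hx))
    (fun z _ => ZMod.natCast_zmod_val z) fun _ _ => rfl

lemma sum_range_val_sub {m : ℕ} [NeZero m] (a : ZMod m) (g : ℕ → ℝ) :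
    ∑ x ∈ range m, g ((x : ZMod m) - a).val = ∑ v ∈ range m, g v := by
  refine (sum_range_eq_sum_zmod fun z : ZMod m => g (z - a).val).trans <|
    (Equiv.sum_comp (Equiv.subRight a) fun z : ZMod m => g z.val).trans <|
    (sum_range_eq_sum_zmod fun z : ZMod m => g z.val).symm.trans ?_
  exact sum_congr rfl fun x hx => by rw [ZMod.val_cast_of_lt (mem_range.mp hx)]

lemma abs_avgZ_nuGT_sub_one_le (k N W m : ℕ) [NeZero m] {η : ℝ} (hR : 1 < Rpar k m)
    (hRm : Rpar k m ^ 4 ≤ m) (hS : |(W.totient : ℝ) / W * selbergForm W (Rpar k m) /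
      Real.log (Rpar k m) - 1| ≤ η) :
    |avgZ m (fun n : ZMod m => nuGT k N W n) - 1| ≤ η + (Rpar k m)⁻¹ := by
  set R := Rpar k m with hRdef
  set L := Real.log R with hLdef
  have hR0 : 0 < R := by linarith
  have hL : 0 < L := Real.log_pos hR
  have hm : (0 : ℝ) < m := by exact_mod_cast Nat.pos_of_ne_zero (NeZero.ne m)
  have hη : 0 ≤ η := (abs_nonneg _).trans hS
  set c := (W.totient : ℝ) / W with hc
  have hc0 : 0 ≤ c := by positivity
  have hc1 : c ≤ 1 := div_le_one_of_le₀ (by exact_mod_cast Nat.totient_le W) (by positivity)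
  set A := ⌈epsk k * m⌉₊
  set B := min (⌊2 * epsk k * m⌋₊ + 1) m
  have hε : 0 ≤ epsk k := by rw [epsk]; positivity
  have hfil : (range m).filter (fun v : ℕ => epsk k * m ≤ (v : ℝ) ∧ (v : ℝ) ≤ 2 * epsk k * m) =
      Ico A B := by
    ext v
    rw [mem_filter, mem_range, mem_Ico, lt_min_iff, Nat.ceil_le, Nat.lt_succ_iff,
      Nat.le_floor_iff (by positivity)]
    tauto
  have h1 : ∑ x ∈ range m, nuGT k N W (x : ZMod m) = ∑ v ∈ range m,
      if epsk k * m ≤ (v : ℝ) ∧ (v : ℝ) ≤ 2 * epsk k * m then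
        c * LambdaR R (W * (N + v) + 1) ^ 2 / L else 1 := by
    refine Eq.trans ?_ (sum_range_val_sub (N : ZMod m) _)
    exact sum_congr rfl fun x _ => by
      simp only [nuGT, inWindow, reprN, c, L, R]
      congr
  have h2 : (∑ x ∈ range m, nuGT k N W (x : ZMod m)) - m =
      ∑ v ∈ Ico A B, (c * LambdaR R (W * (N + v) + 1) ^ 2 / L - 1) := by
    rw [h1, ← hfil, sum_filter]
    have h3 : ∑ v ∈ range m, (1 : ℝ) = m := by simp
    refine (congrArg₂ _ rfl h3.symm).trans ((sum_sub_distrib _ _).symm.trans ?_)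
    refine sum_congr rfl fun v _ => ?_
    split_ifs
    · rfl
    · exact sub_self _
  set S := selbergForm W R
  set T := ∑ v ∈ Ico A B, LambdaR R (W * (N + v) + 1) ^ 2
  set D : ℝ := ((B - A : ℕ) : ℝ)
  have h4 : ∑ v ∈ Ico A B, (c * LambdaR R (W * (N + v) + 1) ^ 2 / L - 1) =
      c / L * (T - D * S) + D * (c * S / L - 1) := by
    rw [sum_sub_distrib, ← sum_div, ← mul_sum, sum_const, Nat.card_Ico, nsmul_eq_mul, mul_one]
    ring
  have hDm : D ≤ m :=
    Nat.cast_le.mpr ((Nat.sub_le _ _).trans (min_le_right _ _))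
  have hT := abs_sum_LambdaR_sq_sub_le A B N W hR.le
  have hlog : L ≤ R := (Real.log_le_sub_one_of_pos hR0).trans (by linarith)
  have h5 : |c / L * (T - D * S)| ≤ m * R⁻¹ := by
    rw [abs_mul, abs_of_nonneg (by positivity)]
    calc _ ≤ 1 / L * (R * L) ^ 2 := by gcongr
      _ = R ^ 2 * L := by field_simp
      _ ≤ R ^ 2 * R := by gcongr
      _ = R ^ 4 * R⁻¹ := by field_simp
      _ ≤ m * R⁻¹ := by gcongr
  have h6 : |D * (c * S / L - 1)| ≤ m * η := by
    rw [abs_mul, abs_of_nonneg (by positivity : 0 ≤ D)]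
    exact mul_le_mul hDm hS (abs_nonneg _) hm.le
  have h7 : avgZ m (fun n : ZMod m => nuGT k N W n) - 1 =
      (c / L * (T - D * S) + D * (c * S / L - 1)) / m := by
    rw [← h4, ← h2, avgZ, sub_div, div_self hm.ne']
  rw [h7, abs_div, abs_of_pos hm, div_le_iff₀ hm]
  refine (abs_add_le _ _).trans ?_
  linarith

lemma Wprim_pos (w : ℕ → ℕ) (N : ℕ) : 0 < Wprim w N :=
  prod_pos fun _ hp => (mem_filter.mp hp).2.pos

lemma lt_of_not_dvd_Wprim (w : ℕ → ℕ) (N : ℕ) {p : ℕ} (hp : p.Prime) (h : ¬ p ∣ Wprim w N) :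
    w N < p := by
  by_contra! hle
  exact h (dvd_prod_of_mem _ (mem_filter.mpr ⟨mem_range.mpr (by omega), hp⟩))

lemma eventually_Wprim_mul_log_le {w : ℕ → ℕ}
    (hwb : ∀ᶠ N : ℕ in atTop, (w N : ℝ) ≤ Real.log (Real.log N) / 2) {κ : ℝ} (hκ : 0 < κ) :
    ∀ᶠ N : ℕ in atTop, Wprim w N * (2 + Real.log (Wprim w N)) ≤ κ * Real.log N := by
  have hlogN : Tendsto (fun N : ℕ => Real.log (N : ℝ)) atTop atTop :=
    Real.tendsto_log_atTop.comp tendsto_natCast_atTop_atTop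
  have ht : Tendsto (fun N : ℕ => Real.log (Real.log (N : ℝ))) atTop atTop :=
    Real.tendsto_log_atTop.comp hlogN
  have h0 : Tendsto (fun t : ℝ => (2 + t) * Real.exp (-(0.3 * t))) atTop (𝓝 0) := by
    have hs : Tendsto (fun t : ℝ => 0.3 * t) atTop atTop :=
      tendsto_id.const_mul_atTop (by norm_num)
    have h1 := (Real.tendsto_pow_mul_exp_neg_atTop_nhds_zero 1).comp hs
    have h2 := (Real.tendsto_pow_mul_exp_neg_atTop_nhds_zero 0).comp hs
    have h3 := (h2.const_mul 2).add (h1.const_mul (1 / 0.3))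
    simp only [mul_zero, add_zero] at h3
    refine h3.congr fun t => ?_
    simp only [Function.comp_apply, pow_zero, pow_one]
    ring
  filter_upwards [hwb, hlogN.eventually_gt_atTop 0, ht.eventually_ge_atTop 0,
    ht.eventually (h0.eventually_lt_const hκ)] with N h1 h2 h3 h4
  set t := Real.log (Real.log (N : ℝ)) with htdef
  have hexp : Real.log N = Real.exp t := (Real.exp_log h2).symm
  have hW1 : (1 : ℝ) ≤ Wprim w N := by exact_mod_cast Wprim_pos w N
  have hW4 : (Wprim w N : ℝ) ≤ 4 ^ (w N) := by exact_mod_cast primorial_le_four_pow (w N)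
  have hlog4 : Real.log 4 ≤ 1.4 := by
    rw [show (4 : ℝ) = 2 ^ 2 by norm_num, Real.log_pow]
    have := Real.log_two_lt_d9
    push_cast
    linarith
  have hlogW : Real.log (Wprim w N) ≤ 0.7 * t := by
    calc Real.log (Wprim w N) ≤ Real.log (4 ^ (w N)) := Real.log_le_log (by linarith) hW4
      _ = w N * Real.log 4 := Real.log_pow _ _
      _ ≤ t / 2 * 1.4 := mul_le_mul h1 hlog4 (Real.log_nonneg (by norm_num)) (by linarith)
      _ = 0.7 * t := by ring
  have hWe : (Wprim w N : ℝ) ≤ Real.exp (0.7 * t) :=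
    (Real.log_le_iff_le_exp (by linarith)).mp hlogW
  calc Wprim w N * (2 + Real.log (Wprim w N)) ≤ Real.exp (0.7 * t) * (2 + t) :=
        mul_le_mul hWe (by linarith) (by linarith [Real.log_nonneg hW1]) (Real.exp_pos _).le
    _ = (2 + t) * Real.exp (-(0.3 * t)) * Real.exp t := by
        rw [mul_assoc, ← Real.exp_add, mul_comm]
        ring_nf
    _ ≤ κ * Real.log N := by
        rw [hexp]
        exact mul_le_mul_of_nonneg_right h4.le (Real.exp_pos _).le

end SieveAverage

/-- `E(ν) = 1 + o(1)`. -/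
theorem nu_mean_one (k : ℕ) (hk : 3 < k)
    (ε : ℝ) (hε : 0 < ε) (M w : ℕ → ℕ)
    (hM : ∀ N, Nat.Prime (M N))
    (hMN : ∀ᶠ N : ℕ in atTop, (N : ℝ) ^ ε < M N ∧ M N ≤ N)
    (hw : Tendsto w atTop atTop)
    (hwb : ∀ᶠ N : ℕ in atTop, (w N : ℝ) ≤ Real.log (Real.log N) / 2) :
    ∀ δ : ℝ, 0 < δ → ∃ N₀ : ℕ, ∀ N ≥ N₀,
      |avgZ (M N) (fun n : ZMod (M N) => nuGT k N (Wprim w N) n) - 1| ≤ δ := by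
  intro δ hδ
  have hη : 0 < min (δ / 2) 1 := by positivity
  obtain ⟨w₀, τ, hτ, R₀, hmain⟩ := abs_selbergForm_div_log_sub_one_le hη (min_le_right _ _)
  set K : ℝ := k * 2 ^ (k + 4) with hK
  have hk' : (4 : ℝ) ≤ k := by exact_mod_cast hk
  have hK4 : 4 ≤ K := by
    have : (1 : ℝ) ≤ 2 ^ (k + 4) := one_le_pow₀ (by norm_num)
    nlinarith
  have hlogN : Tendsto (fun N : ℕ => Real.log (N : ℝ)) atTop atTop :=
    Real.tendsto_log_atTop.comp tendsto_natCast_atTop_atTop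
  have hRlog : ∀ᶠ N : ℕ in atTop, ε / K * Real.log N ≤ Real.log (Rpar k (M N)) := by
    filter_upwards [hMN, eventually_gt_atTop 0] with N hN hN0
    have hN0' : (0 : ℝ) < N := by exact_mod_cast hN0
    have hM0 : (0 : ℝ) < M N := by exact_mod_cast (hM N).pos
    have h1 : ε * Real.log N ≤ Real.log (M N) := by
      rw [← Real.log_rpow hN0']
      exact Real.log_le_log (Real.rpow_pos_of_pos hN0' _) hN.1.le
    rw [Rpar, Real.log_rpow hM0, ← hK, div_mul_eq_mul_div, one_div_mul_eq_div]
    gcongr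
  have hlogR : Tendsto (fun N => Real.log (Rpar k (M N))) atTop atTop :=
    tendsto_atTop_mono' _ hRlog (hlogN.const_mul_atTop (by positivity))
  have hfin : ∀ᶠ N : ℕ in atTop,
      |avgZ (M N) (fun n : ZMod (M N) => nuGT k N (Wprim w N) n) - 1| ≤ δ := by
    filter_upwards [hRlog, hlogR.eventually_ge_atTop
        (max (Real.log (max R₀ 1)) (max 1 (Real.log (2 / δ)))),
      hw.eventually_ge_atTop w₀,
      eventually_Wprim_mul_log_le hwb (show 0 < τ * (ε / K) by positivity)] with N h1 h2 h3 h4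
    have : NeZero (M N) := ⟨(hM N).ne_zero⟩
    have hM1 : (1 : ℝ) ≤ M N := by exact_mod_cast (hM N).one_le
    have hR0 : 0 < Rpar k (M N) := Real.rpow_pos_of_pos (by linarith) _
    have hR1 : 1 < Rpar k (M N) := by
      rw [← Real.log_pos_iff hR0.le]
      have := (le_max_left _ _).trans ((le_max_right _ _).trans h2)
      linarith
    have hRR : R₀ ≤ Rpar k (M N) := (le_max_left _ _).trans
      ((Real.log_le_log_iff (by positivity) hR0).mp ((le_max_left _ _).trans h2))
    have hRδ : 2 / δ ≤ Rpar k (M N) := (Real.log_le_log_iff (by positivity) hR0).mp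
      ((le_max_right _ _).trans ((le_max_right _ _).trans h2))
    have hR4 : Rpar k (M N) ^ 4 ≤ M N := by
      rw [Rpar, ← Real.rpow_natCast, ← Real.rpow_mul (by linarith), ← hK]
      refine (Real.rpow_le_rpow_of_exponent_le hM1 ?_).trans_eq (Real.rpow_one _)
      rw [one_div_mul_eq_div, div_le_one (by linarith)]
      exact_mod_cast hK4
    have hS := hmain (Wprim w N) (w N) (Rpar k (M N)) (Wprim_pos w N) h3
      (fun p hp h => lt_of_not_dvd_Wprim w N hp h) hRR (h4.trans (by
        rw [mul_assoc]
        exact mul_le_mul_of_nonneg_left h1 hτ.le))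
    refine (abs_avgZ_nuGT_sub_one_le k N (Wprim w N) (M N) hR1 hR4 hS).trans ?_
    have h5 : (Rpar k (M N))⁻¹ ≤ δ / 2 := by
      rw [← inv_div]
      exact inv_anti₀ (by positivity) hRδ
    linarith [min_le_left (δ / 2) 1]
  exact eventually_atTop.mp hfin

end
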